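/- arXiv:2309.12947 — 2 statements merged into one kernel-verified Lean document; each statement's English description precedes it below -/
import Mathlib

section
/- Let n ≥ 2 and let f : B → ℝⁿ \ {0} be a K-quasiregular mapping in the Miniowitz class (Min) with constants C₀, α, satisfying the multiplicity condition (M) with exponent 0 ≤ a < n−1 and constant C₁. Fix κ > 0, and let f̃ denote the non-tangential limit function of f (which exists σ-a.e.). Then for every q > 0 there is a constant C depending only on n, q, K, a, α, κ, C₀, C₁ such that for all x ∈ B: |f(x)|^q ≤ C ⨍_{S(x)} |f̃(ω)|^q dσ(ω). -/
open MeasureTheory Metric Set Filter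
open scoped ENNReal NNReal Topology Classical

noncomputable section

abbrev Vec (n : ℕ) := EuclideanSpace ℝ (Fin n)

/-- The open unit ball in `ℝⁿ`. -/
def unitBall (n : ℕ) : Set (Vec n) := Metric.ball 0 1

/-- The unit sphere `S^{n-1}` in `ℝⁿ`. -/
def unitSphere (n : ℕ) : Set (Vec n) := Metric.sphere 0 1

/-- Surface measure on the unit sphere, modelled by `(n-1)`-dimensional
Hausdorff measure restricted to the sphere. -/
def sphMeasure (n : ℕ) : Measure (Vec n) := (μH[(n : ℝ) - 1]).restrict (unitSphere n)

/-- `f` is `K`-quasiregular on the unit ball. -/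
def IsQR (n : ℕ) (K : ℝ) (f : Vec n → Vec n) : Prop :=
  ContinuousOn f (unitBall n) ∧
  (∀ x ∈ unitBall n, DifferentiableAt ℝ f x) ∧
  (∀ᵐ x ∂(volume.restrict (unitBall n)),
    ‖fderiv ℝ f x‖ ^ n ≤ K * (fderiv ℝ f x).det)

/-- The conformal automorphism `T_x` of the unit ball (with `T_0 = id`). -/
def mobiusT (n : ℕ) (x : Vec n) (y : Vec n) : Vec n :=
  if x = 0 then y
  else (‖x‖ ^ 2 * ‖y - (‖x‖ ^ 2)⁻¹ • x‖ ^ 2)⁻¹ •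
    ((1 - ‖x‖ ^ 2) • (y - x) - ‖y - x‖ ^ 2 • x)

/-- The Miniowitz class (Min) with constants `C₀, α`. -/
def InMiniowitz (n : ℕ) (C₀ α : ℝ) (f : Vec n → Vec n) : Prop :=
  ∀ x ∈ unitBall n, ∀ y ∈ unitBall n,
    C₀⁻¹ * ((1 - ‖y‖) / (1 + ‖y‖)) ^ α ≤ ‖f (mobiusT n (-x) y)‖ / ‖f (mobiusT n (-x) 0)‖ ∧
    ‖f (mobiusT n (-x) y)‖ / ‖f (mobiusT n (-x) 0)‖ ≤ C₀ * ((1 + ‖y‖) / (1 - ‖y‖)) ^ α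

/-- The multiplicity condition (M) with exponent `a` and constant `C₁`. -/
def MultCond (n : ℕ) (a C₁ : ℝ) (f : Vec n → Vec n) : Prop :=
  ∀ x ∈ unitBall n, ∀ r : ℝ, 0 < r → r < 1 → ∀ y : Vec n,
    (({z ∈ Metric.ball (0 : Vec n) r | f (mobiusT n (-x) z) = y}).encard : ℝ≥0∞) ≤
      ENNReal.ofReal (C₁ / (1 - r) ^ a)

/-- The non-tangential region `Γ(ω)` with aperture parameter `κ`. -/
def ntRegion (n : ℕ) (κ : ℝ) (ω : Vec n) : Set (Vec n) :=
  {x ∈ unitBall n | ‖x - ω‖ < (1 + κ) * (1 - ‖x‖)}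

/-- The non-tangential maximal function `f*`. -/
def ntMax (n : ℕ) (κ : ℝ) (f : Vec n → Vec n) (ω : Vec n) : ℝ≥0∞ :=
  ⨆ x ∈ ntRegion n κ ω, ENNReal.ofReal ‖f x‖

/-- `f` has the non-tangential limit `L` at `ω`. -/
def HasNTLimit (n : ℕ) (κ : ℝ) (f : Vec n → Vec n) (ω L : Vec n) : Prop :=
  Filter.Tendsto f (𝓝[ntRegion n κ ω] ω) (𝓝 L)

/-- The `p`-th mean of `f` on the sphere of radius `r`. -/
def hardyMean (n : ℕ) (p : ℝ) (f : Vec n → Vec n) (r : ℝ) : ℝ≥0∞ :=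
  (sphMeasure n (unitSphere n))⁻¹ *
    ∫⁻ ω, ENNReal.ofReal (‖f (r • ω)‖ ^ p) ∂(sphMeasure n)

/-- The Hardy `H^p` norm of `f` on the unit ball. -/
def hardyNorm (n : ℕ) (p : ℝ) (f : Vec n → Vec n) : ℝ≥0∞ :=
  (⨆ r ∈ Set.Ioo (0 : ℝ) 1, hardyMean n p f r) ^ (1 / p)

/-- `f` belongs to the Hardy space `H^p`. -/
def MemHp (n : ℕ) (p : ℝ) (f : Vec n → Vec n) : Prop := hardyNorm n p f < ⊤

/-- The `L^p(σ)` norm of a boundary function on the unit sphere. -/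
def lpSphere (n : ℕ) (p : ℝ) (g : Vec n → Vec n) : ℝ≥0∞ :=
  (∫⁻ ω, ENNReal.ofReal (‖g ω‖ ^ p) ∂(sphMeasure n)) ^ (1 / p)

/-- The `L^p(σ)` norm of the non-tangential maximal function `f*`. -/
def ntMaxLp (n : ℕ) (κ p : ℝ) (f : Vec n → Vec n) : ℝ≥0∞ :=
  (∫⁻ ω, (ntMax n κ f ω) ^ p ∂(sphMeasure n)) ^ (1 / p)

/-- `μ` is a Carleson measure on the unit ball with constant `c`. -/
def IsCarleson (n : ℕ) (c : ℝ) (μ : Measure (Vec n)) : Prop :=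
  ∀ ω ∈ unitSphere n, ∀ r : ℝ, 0 < r →
    μ (unitBall n ∩ Metric.ball ω r) ≤ ENNReal.ofReal c * ENNReal.ofReal r ^ ((n : ℝ) - 1)

/-- `μ` is an `α`-Carleson measure on the unit ball with constant `γ`. -/
def IsAlphaCarleson (n : ℕ) (α γ : ℝ) (μ : Measure (Vec n)) : Prop :=
  ∀ ω ∈ unitSphere n, ∀ r : ℝ, 0 < r →
    μ (unitBall n ∩ Metric.ball ω r) ≤
      ENNReal.ofReal γ * ENNReal.ofReal r ^ (α * ((n : ℝ) - 1))

/-- The squared norm of the denominator in the complex-notation form of `mobiusT`. -/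
def mobiusDenom (n : ℕ) (x y : Vec n) : ℝ := 1 - 2 * inner ℝ x y + ‖x‖ ^ 2 * ‖y‖ ^ 2

lemma mobiusT_eq (n : ℕ) (x y : Vec n) :
    mobiusT n x y = (mobiusDenom n x y)⁻¹ • ((1 - ‖x‖ ^ 2) • (y - x) - ‖y - x‖ ^ 2 • x) := by
  unfold mobiusT mobiusDenom
  split_ifs with h
  · simp [h]
  · congr 2
    have hx : ‖x‖ ≠ 0 := norm_ne_zero_iff.mpr h
    rw [norm_sub_sq_real, norm_smul, inner_smul_right, real_inner_comm x y]
    simp only [norm_inv, norm_pow, norm_norm]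
    field_simp
    ring

lemma mobiusDenom_eq (n : ℕ) (x y : Vec n) :
    mobiusDenom n x y = ‖x - y‖ ^ 2 + (1 - ‖x‖ ^ 2) * (1 - ‖y‖ ^ 2) := by
  unfold mobiusDenom
  rw [norm_sub_sq_real]
  ring

lemma one_sub_norm_sq_pos {n : ℕ} {x : Vec n} (hx : x ∈ unitBall n) : 0 < 1 - ‖x‖ ^ 2 := by
  have h : ‖x‖ < 1 := by simpa [unitBall] using hx
  nlinarith [norm_nonneg x]

lemma mobiusDenom_pos {n : ℕ} {x y : Vec n} (hx : x ∈ unitBall n) (hy : y ∈ unitBall n) :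
    0 < mobiusDenom n x y := by
  rw [mobiusDenom_eq]
  have := mul_pos (one_sub_norm_sq_pos hx) (one_sub_norm_sq_pos hy)
  positivity

lemma mobiusT_neg_zero (n : ℕ) (x : Vec n) : mobiusT n (-x) 0 = x := by
  rw [mobiusT_eq]
  simp [mobiusDenom, sub_smul]

lemma mobiusT_add_self {n : ℕ} {x y : Vec n} (hx : x ∈ unitBall n) (hy : y ∈ unitBall n) :
    mobiusT n x y + x =
      ((mobiusDenom n x y)⁻¹ * (1 - ‖x‖ ^ 2)) • (y - ‖y‖ ^ 2 • x) := by
  have hD := (mobiusDenom_pos hx hy).ne'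
  have h1 : (mobiusDenom n x y)⁻¹ • (mobiusDenom n x y • x) = x := inv_smul_smul₀ hD x
  rw [mobiusT_eq, mul_smul]
  conv_lhs => arg 2; rw [← h1]
  rw [← smul_add]
  congr 1
  rw [mobiusDenom_eq, norm_sub_rev y x]
  module

lemma norm_sq_mobiusT_add_self {n : ℕ} {x y : Vec n} (hx : x ∈ unitBall n)
    (hy : y ∈ unitBall n) :
    ‖mobiusT n x y + x‖ ^ 2 = (1 - ‖x‖ ^ 2) ^ 2 * ‖y‖ ^ 2 / mobiusDenom n x y := by
  have hD := (mobiusDenom_pos hx hy).ne'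
  rw [mobiusT_add_self hx hy, norm_smul, mul_pow, norm_sub_sq_real, norm_smul, inner_smul_right,
    real_inner_comm x y]
  simp only [norm_mul, norm_inv, norm_pow, Real.norm_eq_abs, mul_pow, inv_pow, sq_abs]
  have : ‖y‖ ^ 2 - 2 * (‖y‖ ^ 2 * inner ℝ x y) + (‖y‖ ^ 2) ^ 2 * ‖x‖ ^ 2 =
      ‖y‖ ^ 2 * mobiusDenom n x y := by
    unfold mobiusDenom; ring
  rw [this]
  field_simp

lemma one_sub_norm_sq_mobiusT {n : ℕ} {x y : Vec n} (hx : x ∈ unitBall n)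
    (hy : y ∈ unitBall n) :
    1 - ‖mobiusT n x y‖ ^ 2 = (1 - ‖x‖ ^ 2) * (1 - ‖y‖ ^ 2) / mobiusDenom n x y := by
  have hD := (mobiusDenom_pos hx hy).ne'
  have h1 : mobiusT n x y = (mobiusT n x y + x) - x := by abel
  rw [h1, norm_sub_sq_real, norm_sq_mobiusT_add_self hx hy, mobiusT_add_self hx hy,
    real_inner_smul_left, inner_sub_left, real_inner_smul_left, real_inner_self_eq_norm_sq,
    real_inner_comm x y]
  have h2 : inner ℝ x y = (1 + ‖x‖ ^ 2 * ‖y‖ ^ 2 - mobiusDenom n x y) / 2 := by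
    unfold mobiusDenom; ring
  rw [h2]
  field_simp
  ring

lemma mobiusT_mem {n : ℕ} {x y : Vec n} (hx : x ∈ unitBall n) (hy : y ∈ unitBall n) :
    mobiusT n x y ∈ unitBall n := by
  have h := one_sub_norm_sq_mobiusT hx hy
  have h2 : 0 < 1 - ‖mobiusT n x y‖ ^ 2 := by
    rw [h]
    exact div_pos (mul_pos (one_sub_norm_sq_pos hx) (one_sub_norm_sq_pos hy))
      (mobiusDenom_pos hx hy)
  have : ‖mobiusT n x y‖ < 1 := by nlinarith [norm_nonneg (mobiusT n x y)]
  simpa [unitBall] using this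

lemma mobiusT_neg_mobiusT {n : ℕ} {x y : Vec n} (hx : x ∈ unitBall n) (hy : y ∈ unitBall n) :
    mobiusT n (-x) (mobiusT n x y) = y := by
  have hD := (mobiusDenom_pos hx hy).ne'
  have hA := (one_sub_norm_sq_pos hx).ne'
  have h1 : mobiusDenom n (-x) (mobiusT n x y) = (1 - ‖x‖ ^ 2) ^ 2 / mobiusDenom n x y := by
    rw [mobiusDenom_eq, norm_sub_rev, sub_neg_eq_add, norm_sq_mobiusT_add_self hx hy, norm_neg,
      one_sub_norm_sq_mobiusT hx hy]
    field_simp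
    ring
  rw [mobiusT_eq n (-x), h1, sub_neg_eq_add, norm_sq_mobiusT_add_self hx hy,
    mobiusT_add_self hx hy, norm_neg]
  rw [inv_smul_eq_iff₀ (by positivity)]
  module

lemma tsum_indicator_image_le_encard {E F : Type*} (f : E → F) (s : Set E) (t : ℕ → Set E)
    (hts : ∀ i, t i ⊆ s) (ht : Pairwise (Function.onFun Disjoint t)) (y : F) :
    ∑' i, (f '' t i).indicator (fun _ => (1 : ℝ≥0∞)) y ≤
      ({z ∈ s | f z = y}.encard : ℝ≥0∞) := by
  rw [ENNReal.tsum_eq_iSup_sum]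
  refine iSup_le fun u => ?_
  simp only [Set.indicator_apply, Finset.sum_boole]
  set v := u.filter fun i => y ∈ f '' t i with hv
  have hmem : ∀ i ∈ v, ∃ z ∈ t i, f z = y := fun i hi => (Finset.mem_filter.mp hi).2
  rcases v.eq_empty_or_nonempty with he | ⟨i₀, hi₀⟩
  · simp [he]
  have : Nonempty E := ⟨(hmem i₀ hi₀).choose⟩
  choose! z hz hzy using hmem
  have hle : (v : Set ℕ).encard ≤ {z ∈ s | f z = y}.encard := by
    refine Set.encard_le_encard_of_injOn (f := z) (fun i hi => ⟨hts i (hz i hi), hzy i hi⟩) ?_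
    intro i hi j hj hij
    by_contra hne
    exact (Set.disjoint_left.mp (ht hne) (hz i hi)) (hij ▸ hz j hj)
  rw [Set.encard_coe_eq_coe_finsetCard] at hle
  have := ENat.toENNReal_le.mpr hle
  simpa using this

lemma setLIntegral_abs_det_fderiv_mul_le {E : Type*} [NormedAddCommGroup E] [NormedSpace ℝ E]
    [FiniteDimensional ℝ E] [MeasurableSpace E] [BorelSpace E] (μ : Measure E)
    [μ.IsAddHaarMeasure] {f : E → E} {s : Set E} (hs : MeasurableSet s)
    (hf : ∀ x ∈ s, DifferentiableAt ℝ f x) {N : ℝ≥0∞}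
    (hN : ∀ y, ({z ∈ s | f z = y}.encard : ℝ≥0∞) ≤ N) {h : E → ℝ≥0∞} (hh : Measurable h) :
    ∫⁻ x in s, ENNReal.ofReal |(fderiv ℝ f x).det| * h (f x) ∂μ ≤ N * ∫⁻ y, h y ∂μ := by
  have hdet : Measurable fun x => (fderiv ℝ f x).det :=
    ContinuousLinearMap.continuous_det.measurable.comp (measurable_fderiv ℝ f)
  set s' : Set E := {x ∈ s | (fderiv ℝ f x).det ≠ 0} with hs'
  have hs'm : MeasurableSet s' := hs.inter (hdet (measurableSet_singleton 0).compl)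
  let r : (E →L[ℝ] E) → ℝ≥0 := fun A =>
    if hA : A.det ≠ 0 then
      if Subsingleton E then 1
      else ‖((A.toContinuousLinearEquivOfDetNeZero hA).symm : E →L[ℝ] E)‖₊⁻¹ / 2
    else 1
  have rpos : ∀ A, r A ≠ 0 := by
    intro A
    simp only [r]
    split_ifs with hA hE
    · exact one_ne_zero
    · have : Nontrivial E := not_subsingleton_iff_nontrivial.mp hE
      have := (A.toContinuousLinearEquivOfDetNeZero hA).nnnorm_symm_pos
      positivity
    · exact one_ne_zero
  obtain ⟨t, A, tdisj, tmeas, tcov, tapp, tA⟩ :=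
    exists_partition_approximatesLinearOn_of_hasFDerivWithinAt f s' (fderiv ℝ f)
      (fun x hx => (hf x hx.1).hasFDerivAt.hasFDerivWithinAt) r rpos
  have hinj : ∀ i, InjOn f (s' ∩ t i) := by
    intro i
    rcases s'.eq_empty_or_nonempty with he | hne
    · simp [he]
    obtain ⟨y, hy, hyA⟩ := tA hne i
    have hA : (A i).det ≠ 0 := hyA ▸ hy.2
    have happ := tapp i
    have : ApproximatesLinearOn f
        ((A i).toContinuousLinearEquivOfDetNeZero hA : E →L[ℝ] E) (s' ∩ t i) (r (A i)) := by
      simpa using happ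
    refine this.injOn ?_
    by_cases hE : Subsingleton E
    · exact Or.inl hE
    · right
      have : Nontrivial E := not_subsingleton_iff_nontrivial.mp hE
      have hp := ((A i).toContinuousLinearEquivOfDetNeZero hA).nnnorm_symm_pos
      simp only [r, hA, hE, ne_eq, not_false_eq_true, dite_true, if_false]
      exact NNReal.half_lt_self (inv_pos.mpr hp).ne'
  have hunion : (⋃ i, s' ∩ t i) = s' := by
    rw [← inter_iUnion, inter_eq_left]; exact tcov
  have hmeas : ∀ i, MeasurableSet (s' ∩ t i) := fun i => hs'm.inter (tmeas i)
  have hdisj : Pairwise (Function.onFun Disjoint fun i => s' ∩ t i) := fun i j hij =>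
    (tdisj hij).mono inter_subset_right inter_subset_right
  have hder : ∀ i, ∀ x ∈ s' ∩ t i, HasFDerivWithinAt f (fderiv ℝ f x) (s' ∩ t i) x :=
    fun i x hx => (hf x hx.1.1).hasFDerivAt.hasFDerivWithinAt
  have himg : ∀ i, MeasurableSet (f '' (s' ∩ t i)) := fun i =>
    measurable_image_of_fderivWithin (hmeas i) (hder i) (hinj i)
  calc ∫⁻ x in s, ENNReal.ofReal |(fderiv ℝ f x).det| * h (f x) ∂μ
      = ∫⁻ x in s', ENNReal.ofReal |(fderiv ℝ f x).det| * h (f x) ∂μ := by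
        rw [← lintegral_indicator hs, ← lintegral_indicator hs'm]
        congr 1
        ext x
        by_cases hx : x ∈ s <;> by_cases hx' : (fderiv ℝ f x).det = 0 <;>
          simp [Set.indicator, hs', hx, hx']
    _ = ∑' i, ∫⁻ x in s' ∩ t i, ENNReal.ofReal |(fderiv ℝ f x).det| * h (f x) ∂μ := by
        conv_lhs => rw [← hunion]
        exact lintegral_iUnion hmeas hdisj _
    _ = ∑' i, ∫⁻ y, (f '' (s' ∩ t i)).indicator (fun _ => (1 : ℝ≥0∞)) y * h y ∂μ := by
        congr 1
        ext i
        rw [← lintegral_image_eq_lintegral_abs_det_fderiv_mul μ (hmeas i) (hder i) (hinj i),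
          ← lintegral_indicator (himg i)]
        congr 1
        ext y
        by_cases hy : y ∈ f '' (s' ∩ t i) <;> simp only [Set.indicator, hy, if_true, if_false,
          one_mul, zero_mul]
    _ = ∫⁻ y, ∑' i, (f '' (s' ∩ t i)).indicator (fun _ => (1 : ℝ≥0∞)) y * h y ∂μ := by
        rw [lintegral_tsum]
        exact fun i => ((measurable_const.indicator (himg i)).mul hh).aemeasurable
    _ ≤ ∫⁻ y, N * h y ∂μ := by
        refine lintegral_mono fun y => ?_
        rw [ENNReal.tsum_mul_right]
        gcongr
        refine le_trans (tsum_indicator_image_le_encard f s _ (fun i x hx => hx.1.1) hdisj y) (hN y)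
    _ = N * ∫⁻ y, h y ∂μ := lintegral_const_mul N hh

lemma lintegral_annulus_inv_norm_pow (m : ℕ) {a b : ℝ} (ha : 0 < a) (hab : a ≤ b) :
    ∫⁻ w : Vec (m + 1), ENNReal.ofReal ((Icc a b).indicator (fun t => (t ^ (m + 1))⁻¹) ‖w‖) =
      ENNReal.ofReal ((m + 1) * (volume : Measure (Vec (m + 1))).real (ball 0 1) *
        Real.log (b / a)) := by
  have hb : 0 < b := ha.trans_le hab
  have hsub : Icc a b ⊆ Ioi 0 := fun t ht => ha.trans_le ht.1
  have hfun : ∀ y : ℝ, y ^ m • (Icc a b).indicator (fun t => (t ^ (m + 1))⁻¹) y =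
      (Icc a b).indicator (fun t => t⁻¹) y := by
    intro y
    by_cases hy : y ∈ Icc a b
    · have : y ≠ 0 := (hsub hy).ne'
      simp only [Set.indicator, hy, if_true, smul_eq_mul]
      rw [pow_succ]
      field_simp
    · simp [Set.indicator, hy]
  have hdim : Module.finrank ℝ (Vec (m + 1)) - 1 = m := by simp
  have hII : IntegrableOn (fun t : ℝ => t⁻¹) (Icc a b) :=
    (continuousOn_inv₀.mono fun t ht => (hsub ht).ne').integrableOn_compact isCompact_Icc
  have hint : Integrable (fun w : Vec (m + 1) =>
      (Icc a b).indicator (fun t => (t ^ (m + 1))⁻¹) ‖w‖) := by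
    rw [integrable_fun_norm_addHaar volume (f := (Icc a b).indicator fun t => (t ^ (m + 1))⁻¹),
      hdim]
    simp_rw [hfun]
    exact ((integrable_indicator_iff measurableSet_Icc).mpr hII).integrableOn
  rw [← ofReal_integral_eq_lintegral_ofReal hint (ae_of_all _ fun w => ?_)]
  · congr 1
    rw [integral_fun_norm_addHaar volume ((Icc a b).indicator fun t => (t ^ (m + 1))⁻¹), hdim]
    simp_rw [hfun]
    rw [setIntegral_indicator measurableSet_Icc, inter_eq_right.mpr hsub,
      integral_Icc_eq_integral_Ioc, ← intervalIntegral.integral_of_le hab,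
      integral_inv_of_pos ha hb]
    simp [mul_assoc]
  · refine Set.indicator_nonneg (fun t ht => ?_) _
    have : 0 < t := hsub ht
    positivity

/-- The function `‖Df‖ / ‖f‖` on the unit ball, extended by zero. -/
def logGradient (n : ℕ) (f : Vec n → Vec n) : Vec n → ℝ≥0∞ :=
  (unitBall n).indicator fun y => ENNReal.ofReal (‖fderiv ℝ f y‖ / ‖f y‖)

lemma measurable_logGradient {n : ℕ} {f : Vec n → Vec n} (hf : ContinuousOn f (unitBall n)) :
    Measurable (logGradient n f) := by
  have hB : MeasurableSet (unitBall n) := measurableSet_ball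
  have h1 : Measurable ((unitBall n).indicator f) := by
    have := hf.measurable_piecewise (g := fun _ => (0 : Vec n)) continuousOn_const hB
    exact this
  have h2 : logGradient n f = (unitBall n).indicator fun y =>
      ENNReal.ofReal (‖fderiv ℝ f y‖ / ‖(unitBall n).indicator f y‖) := by
    ext y
    by_cases hy : y ∈ unitBall n <;> simp [logGradient, hy]
  rw [h2]
  exact (((measurable_fderiv ℝ f).norm.div h1.norm).ennreal_ofReal).indicator hB

lemma norm_mem_Icc_of_inMiniowitz {n : ℕ} {C₀ α r : ℝ} (hC₀ : 1 ≤ C₀) (hα : 0 < α)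
    {f : Vec n → Vec n} (hf0 : ∀ x ∈ unitBall n, f x ≠ 0) (hM : InMiniowitz n C₀ α f)
    {x y : Vec n} (hx : x ∈ unitBall n) (hy : y ∈ unitBall n) (hr : r < 1)
    (hxy : ‖mobiusT n x y‖ ≤ r) :
    ‖f y‖ ∈ Icc (‖f x‖ * (C₀⁻¹ * ((1 - r) / (1 + r)) ^ α))
      (‖f x‖ * (C₀ * ((1 + r) / (1 - r)) ^ α)) := by
  have hfx : 0 < ‖f x‖ := norm_pos_iff.mpr (hf0 x hx)
  have h := hM x hx _ (mobiusT_mem hx hy)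
  rw [mobiusT_neg_mobiusT hx hy, mobiusT_neg_zero] at h
  set z := ‖mobiusT n x y‖
  have hz0 : 0 ≤ z := norm_nonneg _
  have h1 : (1 - r) / (1 + r) ≤ (1 - z) / (1 + z) := by
    rw [div_le_div_iff₀ (by linarith) (by linarith)]
    nlinarith
  have h2 : (1 + z) / (1 - z) ≤ (1 + r) / (1 - r) := by
    rw [div_le_div_iff₀ (by linarith) (by linarith)]
    nlinarith
  constructor
  · have h3 : C₀⁻¹ * ((1 - r) / (1 + r)) ^ α ≤ ‖f y‖ / ‖f x‖ := by
      refine le_trans ?_ h.1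
      have : 0 ≤ (1 - r) / (1 + r) := div_nonneg (by linarith) (by linarith)
      gcongr
    rw [le_div_iff₀ hfx] at h3
    linarith
  · have h3 : ‖f y‖ / ‖f x‖ ≤ C₀ * ((1 + r) / (1 - r)) ^ α := by
      refine h.2.trans ?_
      have : 0 ≤ (1 + z) / (1 - z) := div_nonneg (by linarith) (by linarith)
      gcongr
    rw [div_le_iff₀ hfx] at h3
    linarith

lemma setLIntegral_logGradient_pow_le {m : ℕ} {K C₀ α a C₁ r : ℝ} (hK : 1 ≤ K) (hC₀ : 1 ≤ C₀)
    (hα : 0 < α) (hC₁ : 0 < C₁) (hr0 : 0 < r) (hr1 : r < 1)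
    {f : Vec (m + 1) → Vec (m + 1)} (hQR : IsQR (m + 1) K f)
    (hf0 : ∀ x ∈ unitBall (m + 1), f x ≠ 0) (hMin : InMiniowitz (m + 1) C₀ α f)
    (hMult : MultCond (m + 1) a C₁ f) {x : Vec (m + 1)} (hx : x ∈ unitBall (m + 1))
    {s : Set (Vec (m + 1))} (hs : MeasurableSet s) (hsB : s ⊆ unitBall (m + 1))
    (hsr : ∀ y ∈ s, ‖mobiusT (m + 1) x y‖ < r) :
    ∫⁻ y in s, logGradient (m + 1) f y ^ (m + 1) ≤
      ENNReal.ofReal (K * (C₁ / (1 - r) ^ a * ((m + 1) *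
        (volume : Measure (Vec (m + 1))).real (ball 0 1) *
          (2 * Real.log C₀ + 2 * α * Real.log ((1 + r) / (1 - r)))))) := by
  have hfx : 0 < ‖f x‖ := norm_pos_iff.mpr (hf0 x hx)
  have h1r : 0 < 1 - r := by linarith
  have hq : 0 < (1 + r) / (1 - r) := by positivity
  have hC₀' : 0 < C₀ := by linarith
  set lo := ‖f x‖ * (C₀⁻¹ * ((1 - r) / (1 + r)) ^ α) with hlo
  set hi := ‖f x‖ * (C₀ * ((1 + r) / (1 - r)) ^ α) with hhi
  have hlo0 : 0 < lo := by positivity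
  have hbd : ∀ y ∈ s, ‖f y‖ ∈ Icc lo hi := fun y hy =>
    norm_mem_Icc_of_inMiniowitz hC₀ hα hf0 hMin hx (hsB hy) hr1 (hsr y hy).le
  have hratio : hi / lo = C₀ ^ 2 * (((1 + r) / (1 - r)) ^ α) ^ 2 := by
    have : (1 - r) / (1 + r) = ((1 + r) / (1 - r))⁻¹ := by rw [inv_div]
    rw [hhi, hlo, this, Real.inv_rpow hq.le]
    have : 0 < ((1 + r) / (1 - r)) ^ α := by positivity
    field_simp
  have hq1 : 1 ≤ (1 + r) / (1 - r) := by rw [le_div_iff₀ h1r]; linarith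
  have hlohi : lo ≤ hi := by
    rw [← one_le_div hlo0, hratio]
    have := Real.one_le_rpow hq1 hα.le
    nlinarith [one_le_pow₀ hC₀ (n := 2), one_le_pow₀ this (n := 2)]
  have hlog : Real.log (hi / lo) =
      2 * Real.log C₀ + 2 * α * Real.log ((1 + r) / (1 - r)) := by
    rw [hratio, Real.log_mul (by positivity) (by positivity), Real.log_pow, Real.log_pow,
      Real.log_rpow hq]
    push_cast
    ring
  set h : Vec (m + 1) → ℝ≥0∞ := fun w =>
    ENNReal.ofReal ((Icc lo hi).indicator (fun t => (t ^ (m + 1))⁻¹) ‖w‖) with hh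
  have hhm : Measurable h := by
    refine Measurable.ennreal_ofReal ?_
    exact ((by fun_prop : Measurable fun t : ℝ => (t ^ (m + 1))⁻¹).indicator
      measurableSet_Icc).comp measurable_norm
  have hpt : ∀ᵐ y ∂(volume.restrict s), logGradient (m + 1) f y ^ (m + 1) ≤
      ENNReal.ofReal K * (ENNReal.ofReal |(fderiv ℝ f y).det| * h (f y)) := by
    filter_upwards [ae_restrict_of_ae_restrict_of_subset hsB hQR.2.2, ae_restrict_mem hs]
      with y hy hys
    have hfy : 0 < ‖f y‖ := norm_pos_iff.mpr (hf0 y (hsB hys))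
    rw [logGradient, Set.indicator_of_mem (hsB hys), hh]
    simp only [Set.indicator_of_mem (hbd y hys)]
    rw [← ENNReal.ofReal_pow (by positivity), ← ENNReal.ofReal_mul (abs_nonneg _),
      ← ENNReal.ofReal_mul (by linarith)]
    refine ENNReal.ofReal_le_ofReal ?_
    rw [div_pow, div_eq_mul_inv, ← mul_assoc]
    gcongr
    exact hy.trans (by gcongr; exact le_abs_self _)
  have hN : ∀ w, ({z ∈ s | f z = w}.encard : ℝ≥0∞) ≤ ENNReal.ofReal (C₁ / (1 - r) ^ a) := by
    intro w
    refine le_trans ?_ (hMult x hx r hr0 hr1 w)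
    refine ENat.toENNReal_le.mpr ?_
    refine Set.encard_le_encard_of_injOn (f := mobiusT (m + 1) x) ?_ ?_
    · rintro z ⟨hz, hzw⟩
      refine ⟨by simpa using hsr z hz, ?_⟩
      rw [mobiusT_neg_mobiusT hx (hsB hz), hzw]
    · rintro z ⟨hz, -⟩ z' ⟨hz', -⟩ hzz
      rw [← mobiusT_neg_mobiusT hx (hsB hz), hzz, mobiusT_neg_mobiusT hx (hsB hz')]
  calc ∫⁻ y in s, logGradient (m + 1) f y ^ (m + 1)
      ≤ ∫⁻ y in s, ENNReal.ofReal K * (ENNReal.ofReal |(fderiv ℝ f y).det| * h (f y)) :=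
        lintegral_mono_ae hpt
    _ = ENNReal.ofReal K * ∫⁻ y in s, ENNReal.ofReal |(fderiv ℝ f y).det| * h (f y) :=
        lintegral_const_mul' _ _ ENNReal.ofReal_ne_top
    _ ≤ ENNReal.ofReal K * (ENNReal.ofReal (C₁ / (1 - r) ^ a) * ∫⁻ w, h w) := by
        gcongr
        exact setLIntegral_abs_det_fderiv_mul_le volume hs (fun y hy => hQR.2.1 y (hsB hy)) hN hhm
    _ = _ := by
        rw [hh, lintegral_annulus_inv_norm_pow m hlo0 hlohi, hlog,
          ← ENNReal.ofReal_mul (by positivity), ← ENNReal.ofReal_mul (by linarith)]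

lemma exists_forall_setLIntegral_logGradient_pow_le (m : ℕ) {K C₀ α a C₁ : ℝ} (hK : 1 ≤ K)
    (hC₀ : 1 ≤ C₀) (hα : 0 < α) (hC₁ : 0 < C₁) :
    ∃ A : ℝ, 0 ≤ A ∧ ∀ f : Vec (m + 1) → Vec (m + 1), IsQR (m + 1) K f →
      (∀ x ∈ unitBall (m + 1), f x ≠ 0) → InMiniowitz (m + 1) C₀ α f →
      MultCond (m + 1) a C₁ f → ∀ x ∈ unitBall (m + 1), ∀ (k : ℕ) (s : Set (Vec (m + 1))),
      MeasurableSet s → s ⊆ unitBall (m + 1) →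
      (∀ y ∈ s, ‖mobiusT (m + 1) x y‖ < 1 - (1 / 2) ^ (k + 6)) →
      ∫⁻ y in s, logGradient (m + 1) f y ^ (m + 1) ≤
        ENNReal.ofReal (A * ((k + 7) * (2 ^ a) ^ k)) := by
  have hlC : 0 ≤ Real.log C₀ := Real.log_nonneg hC₀
  set V := (volume : Measure (Vec (m + 1))).real (ball 0 1)
  have hV : 0 ≤ V := measureReal_nonneg
  have hK0 : 0 < K := by linarith
  refine ⟨K * (C₁ * ((2 ^ a) ^ 6 * ((m + 1) * V * (2 * Real.log C₀ + 2 * α)))), by positivity,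
    fun f hQR hf0 hMin hMult x hx k s hs hsB hsr => ?_⟩
  set ε : ℝ := (1 / 2) ^ (k + 6) with hε
  have hε0 : 0 < ε := by positivity
  have hε1 : ε < 1 := pow_lt_one₀ (by norm_num) (by norm_num) (by omega)
  refine (setLIntegral_logGradient_pow_le hK hC₀ hα hC₁ (by linarith) (by linarith) hQR hf0 hMin
    hMult hx hs hsB hsr).trans (ENNReal.ofReal_le_ofReal ?_)
  have e1 : (1 - (1 - ε)) = ε := by ring
  rw [e1]
  have e2 : C₁ / ε ^ a = C₁ * ((2 ^ a) ^ 6 * (2 ^ a) ^ k) := by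
    have h2 : ε = ((2 : ℝ) ^ (k + 6))⁻¹ := by rw [hε, one_div, inv_pow]
    rw [h2, Real.inv_rpow (by positivity), div_inv_eq_mul, ← Real.rpow_natCast, ← Real.rpow_mul
      (by norm_num), mul_comm _ a, Real.rpow_mul (by norm_num), Real.rpow_natCast, ← pow_add,
      add_comm 6 k]
  have e3 : Real.log ((1 + (1 - ε)) / ε) ≤ k + 7 := by
    have h1 : (1 + (1 - ε)) / ε ≤ 2 ^ (k + 7) := by
      rw [div_le_iff₀ hε0]
      have : (2 : ℝ) ^ (k + 7) * ε = 2 := by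
        rw [hε, pow_succ (2 : ℝ) (k + 6), one_div, inv_pow]
        field_simp
      linarith
    calc Real.log ((1 + (1 - ε)) / ε) ≤ Real.log (2 ^ (k + 7)) :=
          Real.log_le_log (div_pos (by linarith) hε0) h1
      _ = (k + 7) * Real.log 2 := by rw [Real.log_pow]; push_cast; ring
      _ ≤ (k + 7) * 1 := by
          gcongr
          linarith [Real.log_two_lt_d9]
      _ = k + 7 := mul_one _
  rw [e2]
  have e4 : 2 * Real.log C₀ + 2 * α * Real.log ((1 + (1 - ε)) / ε) ≤
      (2 * Real.log C₀ + 2 * α) * (k + 7) := by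
    have : 2 * α * Real.log ((1 + (1 - ε)) / ε) ≤ 2 * α * (k + 7) := by gcongr
    have : (0 : ℝ) ≤ k := k.cast_nonneg
    nlinarith
  calc _ ≤ K * (C₁ * ((2 ^ a) ^ 6 * (2 ^ a) ^ k) * ((m + 1) * V *
        ((2 * Real.log C₀ + 2 * α) * (k + 7)))) := by gcongr
    _ = _ := by ring

lemma exists_linearIsometryEquiv_prod (m : ℕ) {e : Vec (m + 1)} (he : ‖e‖ = 1) :
    ∃ A : WithLp 2 (ℝ × Vec m) ≃ₗᵢ[ℝ] Vec (m + 1), A (WithLp.toLp 2 (1, 0)) = e := by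
  have hd : Module.finrank ℝ (WithLp 2 (ℝ × Vec m)) = Module.finrank ℝ (Vec (m + 1)) := by
    rw [(WithLp.linearEquiv 2 ℝ (ℝ × Vec m)).finrank_eq]
    simp [add_comm]
  let A₀ : WithLp 2 (ℝ × Vec m) ≃ₗᵢ[ℝ] Vec (m + 1) :=
    ((stdOrthonormalBasis ℝ (WithLp 2 (ℝ × Vec m))).reindex (finCongr hd)).repr.trans
      (stdOrthonormalBasis ℝ (Vec (m + 1))).repr.symm
  have h1 : ‖A₀ (WithLp.toLp 2 (1, 0))‖ = ‖e‖ := by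
    rw [A₀.norm_map, he]
    simp
  exact ⟨A₀.trans (ℝ ∙ (A₀ (WithLp.toLp 2 (1, 0)) - e))ᗮ.reflection,
    Submodule.reflection_sub h1⟩

/-- Coordinates on `ℝ^{m+1}` adapted to an orthogonal splitting into a line and a hyperplane. -/
def axisMap {m : ℕ} (A : WithLp 2 (ℝ × Vec m) ≃ₗᵢ[ℝ] Vec (m + 1)) (p : ℝ × Vec m) :
    Vec (m + 1) := A (WithLp.toLp 2 p)

/-- The hyperplane component in the coordinates of `axisMap`. -/
def axisProj {m : ℕ} (A : WithLp 2 (ℝ × Vec m) ≃ₗᵢ[ℝ] Vec (m + 1)) (y : Vec (m + 1)) : Vec m :=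
  (A.symm y).snd

/-- The line component in the coordinates of `axisMap`. -/
def axisHeight {m : ℕ} (A : WithLp 2 (ℝ × Vec m) ≃ₗᵢ[ℝ] Vec (m + 1)) (y : Vec (m + 1)) : ℝ :=
  (A.symm y).fst

section axis
variable {m : ℕ} (A : WithLp 2 (ℝ × Vec m) ≃ₗᵢ[ℝ] Vec (m + 1))

lemma norm_sq_axisMap (p : ℝ × Vec m) : ‖axisMap A p‖ ^ 2 = p.1 ^ 2 + ‖p.2‖ ^ 2 := by
  rw [axisMap, A.norm_map, WithLp.prod_norm_sq_eq_of_L2]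
  simp

lemma axisMap_sub (p p' : ℝ × Vec m) : axisMap A p - axisMap A p' = axisMap A (p - p') := by
  simp [axisMap, ← map_sub]

lemma axisProj_axisMap (p : ℝ × Vec m) : axisProj A (axisMap A p) = p.2 := by
  simp [axisProj, axisMap]

lemma axisHeight_axisMap (p : ℝ × Vec m) : axisHeight A (axisMap A p) = p.1 := by
  simp [axisHeight, axisMap]

lemma axisMap_axisHeight_axisProj (y : Vec (m + 1)) :
    axisMap A (axisHeight A y, axisProj A y) = y := by
  simp only [axisMap, axisHeight, axisProj]
  exact A.apply_symm_apply y

lemma continuous_axisMap : Continuous (axisMap A) :=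
  A.continuous.comp (WithLp.prod_continuous_toLp 2 ℝ (Vec m))

lemma norm_sq_eq_axis (y : Vec (m + 1)) :
    ‖y‖ ^ 2 = axisHeight A y ^ 2 + ‖axisProj A y‖ ^ 2 := by
  conv_lhs => rw [← axisMap_axisHeight_axisProj A y]
  rw [norm_sq_axisMap]

lemma lipschitzWith_axisProj : LipschitzWith 1 (axisProj A) := by
  refine LipschitzWith.of_dist_le_mul fun x y => ?_
  have h := norm_sq_eq_axis A (x - y)
  have h1 : axisProj A (x - y) = axisProj A x - axisProj A y := by simp [axisProj]
  rw [dist_eq_norm, dist_eq_norm, ← h1, NNReal.coe_one, one_mul]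
  nlinarith [sq_nonneg (axisHeight A (x - y)), norm_nonneg (x - y),
    norm_nonneg (axisProj A (x - y))]

lemma continuous_axisHeight : Continuous (axisHeight A) := by
  have : Continuous fun y => (WithLp.ofLp (A.symm y)).1 :=
    continuous_fst.comp ((WithLp.prod_continuous_ofLp 2 ℝ (Vec m)).comp A.symm.continuous)
  exact this

lemma measurePreserving_axisMap :
    MeasurePreserving (axisMap A) ((volume : Measure ℝ).prod volume) volume :=
  A.measurePreserving.comp (WithLp.volume_preserving_toLp ℝ (Vec m))

lemma axisMap_eq (t : ℝ) (v : Vec m) :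
    axisMap A (t, v) = t • axisMap A (1, 0) + axisMap A (0, v) := by
  simp only [axisMap, ← map_smul, ← map_add]
  congr 1
  rw [← WithLp.toLp_smul, ← WithLp.toLp_add]
  simp

lemma hasDerivAt_axisMap (t : ℝ) (v : Vec m) :
    HasDerivAt (fun s => axisMap A (s, v)) (axisMap A (1, 0)) t := by
  have : (fun s => axisMap A (s, v)) = fun s => s • axisMap A (1, 0) + axisMap A (0, v) :=
    funext fun s => axisMap_eq A s v
  rw [this]
  simpa using ((hasDerivAt_id t).smul_const (axisMap A (1, 0))).add_const (axisMap A (0, v))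

end axis

lemma norm_mul_exp_neg_le_of_lintegral_le {n : ℕ} {f : Vec n → Vec n}
    (hf : ∀ x ∈ unitBall n, DifferentiableAt ℝ f x) (hf0 : ∀ x ∈ unitBall n, f x ≠ 0)
    {p : ℝ → Vec n} {e : Vec n} (he : ‖e‖ = 1) {t₀ t M : ℝ} (ht : t₀ ≤ t) (hM : 0 ≤ M)
    (hp : ∀ s ∈ Icc t₀ t, HasDerivAt p e s) (hpB : ∀ s ∈ Icc t₀ t, p s ∈ unitBall n)
    (hint : ∫⁻ s in Ioc t₀ t, logGradient n f (p s) ≤ ENNReal.ofReal M) :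
    ‖f (p t₀)‖ * Real.exp (-M) ≤ ‖f (p t)‖ := by
  set ψ : ℝ → ℝ := fun s => Real.log (‖f (p s)‖ ^ 2) with hψ
  have hpos : ∀ s ∈ Icc t₀ t, 0 < ‖f (p s)‖ := fun s hs => norm_pos_iff.mpr (hf0 _ (hpB s hs))
  have hder : ∀ s ∈ Icc t₀ t, HasDerivAt ψ
      (2 * inner ℝ (f (p s)) (fderiv ℝ f (p s) e) / ‖f (p s)‖ ^ 2) s := by
    intro s hs
    have h1 : HasDerivAt (f ∘ p) (fderiv ℝ f (p s) e) s :=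
      (hf _ (hpB s hs)).hasFDerivAt.comp_hasDerivAt s (hp s hs)
    exact h1.norm_sq.log (pow_pos (hpos s hs) 2).ne'
  have hbound : ∀ s ∈ Icc t₀ t, ‖deriv ψ s‖ₑ ≤ 2 * logGradient n f (p s) := by
    intro s hs
    have h0 := hpos s hs
    rw [(hder s hs).deriv, logGradient, Set.indicator_of_mem (hpB s hs), ← ofReal_norm,
      Real.norm_eq_abs, abs_div, abs_mul, abs_two, abs_of_pos (pow_pos h0 2)]
    have h2 : (2 : ℝ≥0∞) * ENNReal.ofReal (‖fderiv ℝ f (p s)‖ / ‖f (p s)‖) =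
        ENNReal.ofReal (2 * (‖fderiv ℝ f (p s)‖ / ‖f (p s)‖)) := by
      rw [ENNReal.ofReal_mul (by norm_num), ENNReal.ofReal_ofNat]
    rw [h2]
    refine ENNReal.ofReal_le_ofReal ?_
    have h1 : |inner ℝ (f (p s)) (fderiv ℝ f (p s) e)| ≤ ‖f (p s)‖ * ‖fderiv ℝ f (p s)‖ := by
      refine (abs_real_inner_le_norm _ _).trans ?_
      gcongr
      simpa [he] using (fderiv ℝ f (p s)).le_opNorm e
    rw [div_le_iff₀ (pow_pos h0 2)]
    calc 2 * |inner ℝ (f (p s)) (fderiv ℝ f (p s) e)|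
        ≤ 2 * (‖f (p s)‖ * ‖fderiv ℝ f (p s)‖) := by gcongr
      _ = 2 * (‖fderiv ℝ f (p s)‖ / ‖f (p s)‖) * ‖f (p s)‖ ^ 2 := by field_simp
  have hle : ∫⁻ s in Ioc t₀ t, ‖deriv ψ s‖ₑ ≤ ENNReal.ofReal (2 * M) := by
    calc ∫⁻ s in Ioc t₀ t, ‖deriv ψ s‖ₑ
        ≤ ∫⁻ s in Ioc t₀ t, 2 * logGradient n f (p s) :=
          setLIntegral_mono' measurableSet_Ioc fun s hs => hbound s (Ioc_subset_Icc_self hs)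
      _ = 2 * ∫⁻ s in Ioc t₀ t, logGradient n f (p s) :=
          lintegral_const_mul' _ _ (by norm_num)
      _ ≤ 2 * ENNReal.ofReal M := by gcongr
      _ = ENNReal.ofReal (2 * M) := by
          rw [ENNReal.ofReal_mul (by norm_num), ENNReal.ofReal_ofNat]
  have hii : IntervalIntegrable (deriv ψ) volume t₀ t := by
    rw [intervalIntegrable_iff_integrableOn_Ioc_of_le ht]
    exact ⟨(measurable_deriv ψ).aestronglyMeasurable, hle.trans_lt ENNReal.ofReal_lt_top⟩
  have hftc : ∫ s in t₀..t, deriv ψ s = ψ t - ψ t₀ :=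
    intervalIntegral.integral_eq_sub_of_hasDerivAt (fun s hs => by
      rw [uIcc_of_le ht] at hs
      exact (hder s hs).differentiableAt.hasDerivAt) hii
  have habs : |ψ t - ψ t₀| ≤ 2 * M := by
    rw [← hftc, intervalIntegral.integral_of_le ht, ← Real.norm_eq_abs,
      ← ENNReal.ofReal_le_ofReal_iff (by positivity), ofReal_norm]
    exact (enorm_integral_le_lintegral_enorm _).trans hle
  have h0 := hpos t₀ ⟨le_rfl, ht⟩
  have h1 := hpos t ⟨ht, le_rfl⟩
  have h2 := (abs_le.mp habs).1
  simp only [hψ, Real.log_pow] at h2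
  push_cast at h2
  have h3 : Real.log ‖f (p t₀)‖ - M ≤ Real.log ‖f (p t)‖ := by linarith
  calc ‖f (p t₀)‖ * Real.exp (-M) = Real.exp (Real.log ‖f (p t₀)‖ - M) := by
        rw [sub_eq_add_neg, Real.exp_add, Real.exp_log h0]
    _ ≤ Real.exp (Real.log ‖f (p t)‖) := Real.exp_le_exp.mpr h3
    _ = ‖f (p t)‖ := Real.exp_log h1

/-- Height of the upper unit hemisphere above the point `v` of the equatorial hyperplane. -/
def capHeight {m : ℕ} (v : Vec m) : ℝ := Real.sqrt (1 - ‖v‖ ^ 2)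

lemma continuous_capHeight {m : ℕ} : Continuous (capHeight (m := m)) := by
  unfold capHeight
  fun_prop

lemma capHeight_le_one {m : ℕ} (v : Vec m) : capHeight v ≤ 1 := by
  refine Real.sqrt_le_iff.mpr ⟨zero_le_one, ?_⟩
  linarith [sq_nonneg ‖v‖]

lemma capHeight_nonneg {m : ℕ} (v : Vec m) : 0 ≤ capHeight v := Real.sqrt_nonneg _

lemma capHeight_sq {m : ℕ} {v : Vec m} (hv : ‖v‖ ≤ 1) : capHeight v ^ 2 = 1 - ‖v‖ ^ 2 := by
  rw [capHeight, Real.sq_sqrt]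
  nlinarith [norm_nonneg v]

lemma half_le_capHeight {m : ℕ} {v : Vec m} (hv : ‖v‖ ≤ 1 / 2) : 1 / 2 ≤ capHeight v := by
  rw [capHeight]
  refine Real.le_sqrt_of_sq_le ?_
  nlinarith [norm_nonneg v]

lemma axisMap_mem_unitBall {m : ℕ} (A : WithLp 2 (ℝ × Vec m) ≃ₗᵢ[ℝ] Vec (m + 1)) {t : ℝ}
    {v : Vec m} (hv : ‖v‖ ≤ 1) (ht0 : 0 ≤ t) (ht : t < capHeight v) :
    axisMap A (t, v) ∈ unitBall (m + 1) := by
  have h1 := norm_sq_axisMap A (t, v)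
  have h2 := capHeight_sq hv
  simp only at h1
  have h3 : ‖axisMap A (t, v)‖ < 1 := by
    nlinarith [norm_nonneg (axisMap A (t, v))]
  simpa [unitBall] using h3

lemma cap_denominator_le {ρ t τ s : ℝ} (hρ0 : 0 ≤ ρ) (hρ1 : ρ < 1) (hs0 : 0 ≤ s)
    (hs : s ≤ (1 - ρ) / 2) (ht : ρ ≤ t) (htτ : t < τ) (hτ1 : τ ≤ 1) (hτ2 : τ ^ 2 = 1 - s ^ 2) :
    (ρ - t) ^ 2 + s ^ 2 + (1 - (ρ ^ 2 + 0 ^ 2)) * (1 - (t ^ 2 + s ^ 2)) ≤ 6 * (1 - ρ) ^ 2 := by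
  have h1 : (ρ - t) ^ 2 ≤ (1 - ρ) ^ 2 := by
    rw [← neg_sq]
    exact pow_le_pow_left₀ (by linarith) (by linarith) 2
  have h2 : s ^ 2 ≤ (1 - ρ) ^ 2 := pow_le_pow_left₀ hs0 (by linarith) 2
  have h3 : 1 - (ρ ^ 2 + 0 ^ 2) ≤ 2 * (1 - ρ) := by nlinarith
  have h4 : 1 - (t ^ 2 + s ^ 2) ≤ 2 * (1 - ρ) := by nlinarith
  have h5 : 0 ≤ 1 - (t ^ 2 + s ^ 2) := by nlinarith
  have h6 : (1 - (ρ ^ 2 + 0 ^ 2)) * (1 - (t ^ 2 + s ^ 2)) ≤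
      (2 * (1 - ρ)) * (2 * (1 - ρ)) := mul_le_mul h3 h4 h5 (by linarith)
  have h7 : (2 * (1 - ρ)) * (2 * (1 - ρ)) = 4 * (1 - ρ) ^ 2 := by ring
  linarith

lemma lt_of_one_sub_sq_eq_div {ρ t τ s w D z : ℝ} (hρ0 : 0 ≤ ρ) (hρ1 : ρ < 1) (hs0 : 0 ≤ s)
    (hs : s ≤ (1 - ρ) / 2) (ht : ρ ≤ t) (hτ : 1 / 2 ≤ τ) (hτ1 : τ ≤ 1) (hτ2 : τ ^ 2 = 1 - s ^ 2)
    (hw0 : 0 < w) (hw : 32 * w * (1 - ρ) < τ - t) (hD0 : 0 < D)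
    (hD : D = (ρ - t) ^ 2 + s ^ 2 + (1 - (ρ ^ 2 + 0 ^ 2)) * (1 - (t ^ 2 + s ^ 2)))
    (hz : 1 - z ^ 2 = (1 - (ρ ^ 2 + 0 ^ 2)) * (1 - (t ^ 2 + s ^ 2)) / D) :
    z < 1 - w := by
  have hδ : 0 < 1 - ρ := by linarith
  have h3 : 0 < τ - t := lt_of_le_of_lt (by positivity) hw
  have hnum1 : 1 - (t ^ 2 + s ^ 2) = (τ - t) * (τ + t) := by linear_combination -hτ2
  have hDle : D ≤ 6 * (1 - ρ) ^ 2 := by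
    rw [hD]
    exact cap_denominator_le hρ0 hρ1 hs0 hs ht (by linarith) hτ1 hτ2
  have hnum : 16 * w * (1 - ρ) ^ 2 < (1 - (ρ ^ 2 + 0 ^ 2)) * (1 - (t ^ 2 + s ^ 2)) := by
    have h1 : 1 - ρ ≤ 1 - (ρ ^ 2 + 0 ^ 2) := by linarith [mul_nonneg hρ0 hδ.le, sq ρ]
    have h2 : 16 * w * (1 - ρ) < (τ - t) * (τ + t) := by
      have h4 : (τ - t) * (1 / 2) ≤ (τ - t) * (τ + t) :=
        mul_le_mul_of_nonneg_left (by linarith) h3.le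
      linarith
    rw [hnum1]
    calc 16 * w * (1 - ρ) ^ 2 = (1 - ρ) * (16 * w * (1 - ρ)) := by ring
      _ < (1 - ρ) * ((τ - t) * (τ + t)) := mul_lt_mul_of_pos_left h2 hδ
      _ ≤ _ := mul_le_mul_of_nonneg_right h1 (mul_nonneg h3.le (by linarith))
  have hz' : 2 * w < 1 - z ^ 2 := by
    rw [hz, lt_div_iff₀ hD0]
    calc 2 * w * D ≤ 2 * w * (6 * (1 - ρ) ^ 2) := by gcongr
      _ ≤ 16 * w * (1 - ρ) ^ 2 := by linarith [mul_pos hw0 (pow_pos hδ 2)]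
      _ < _ := hnum
  nlinarith [sq_nonneg (1 - z)]

lemma norm_mobiusT_axisMap_lt {m : ℕ} (A : WithLp 2 (ℝ × Vec m) ≃ₗᵢ[ℝ] Vec (m + 1)) {ρ t : ℝ}
    {v : Vec m} (hρ0 : 0 ≤ ρ) (hρ1 : ρ < 1) (hv : ‖v‖ ≤ (1 - ρ) / 2) (ht : ρ ≤ t) {k : ℕ}
    (hk : (1 / 2) ^ (k + 1) * (1 - ρ) < capHeight v - t) :
    ‖mobiusT (m + 1) (axisMap A (ρ, 0)) (axisMap A (t, v))‖ < 1 - (1 / 2) ^ (k + 6) := by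
  have hδ : 0 < 1 - ρ := by linarith
  have hw6 : (1 / 2 : ℝ) ^ (k + 1) = 32 * (1 / 2) ^ (k + 6) := by
    rw [pow_add _ k 1, pow_add _ k 6]; ring
  have hw0 : (0 : ℝ) < (1 / 2) ^ (k + 6) := by positivity
  rw [hw6] at hk
  generalize (1 / 2 : ℝ) ^ (k + 6) = w at hk hw0 ⊢
  have htτ : t < capHeight v := by
    have : 0 < 32 * w * (1 - ρ) := by positivity
    linarith
  have hx : axisMap A (ρ, 0) ∈ unitBall (m + 1) :=
    axisMap_mem_unitBall A (by simp) hρ0 (by simpa [capHeight] using hρ1)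
  have hy := axisMap_mem_unitBall A (v := v) (by linarith) (hρ0.trans ht) htτ
  have hx2 := norm_sq_axisMap A (ρ, (0 : Vec m))
  have hy2 := norm_sq_axisMap A (t, v)
  have hxy2 := norm_sq_axisMap A ((ρ, (0 : Vec m)) - (t, v))
  rw [← axisMap_sub] at hxy2
  have hD := mobiusDenom_eq (m + 1) (axisMap A (ρ, 0)) (axisMap A (t, v))
  have hid := one_sub_norm_sq_mobiusT hx hy
  rw [hxy2, hx2, hy2] at hD
  rw [hx2, hy2] at hid
  simp only [Prod.fst_sub, Prod.snd_sub, zero_sub, norm_neg, norm_zero] at hD hid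
  exact lt_of_one_sub_sq_eq_div hρ0 hρ1 (norm_nonneg v) hv ht (half_le_capHeight (by linarith))
    (capHeight_le_one v) (capHeight_sq (by linarith)) hw0 hk (mobiusDenom_pos hx hy) hD
    hid

lemma le_mul_pow_succ_add_inv (m : ℕ) (u : ℝ≥0∞) {b : ℝ} (hb : 0 < b) :
    u ≤ ENNReal.ofReal (b ^ m) * u ^ (m + 1) + ENNReal.ofReal b⁻¹ := by
  by_cases hu : u ≤ ENNReal.ofReal b⁻¹
  · exact hu.trans le_add_self
  · have h1 : 1 ≤ ENNReal.ofReal b * u := by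
      calc (1 : ℝ≥0∞) = ENNReal.ofReal b * ENNReal.ofReal b⁻¹ := by
            rw [← ENNReal.ofReal_mul hb.le, mul_inv_cancel₀ hb.ne', ENNReal.ofReal_one]
        _ ≤ ENNReal.ofReal b * u := by gcongr; exact (not_le.mp hu).le
    refine le_trans ?_ (le_self_add)
    calc u = 1 ^ m * u := by simp
      _ ≤ (ENNReal.ofReal b * u) ^ m * u := by gcongr
      _ = ENNReal.ofReal (b ^ m) * u ^ (m + 1) := by
        rw [mul_pow, ENNReal.ofReal_pow hb.le, pow_succ, mul_assoc]

/-- A dyadic layer, in the coordinates of `axisMap`, of the region between the point at height `ρ`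
and the sphere. -/
def capLayer (m : ℕ) (ρ : ℝ) (k : ℕ) : Set (ℝ × Vec m) :=
  {p | ‖p.2‖ < (1 - ρ) / 2 ∧ ρ < p.1 ∧ (1 / 2) ^ (k + 1) * (1 - ρ) < capHeight p.2 - p.1 ∧
    capHeight p.2 - p.1 ≤ (1 / 2) ^ k * (1 - ρ)}

lemma measurableSet_capLayer (m : ℕ) (ρ : ℝ) (k : ℕ) : MeasurableSet (capLayer m ρ k) := by
  have hc := (continuous_capHeight (m := m)).comp (continuous_snd (X := ℝ))
  have h := hc.sub continuous_fst
  exact (measurableSet_lt measurable_snd.norm measurable_const).inter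
    ((measurableSet_lt measurable_const measurable_fst).inter
      ((measurableSet_lt measurable_const h.measurable).inter
        (measurableSet_le h.measurable measurable_const)))

lemma volume_capLayer_le (m : ℕ) {ρ : ℝ} (hρ1 : ρ < 1) (k : ℕ) :
    ((volume : Measure ℝ).prod (volume : Measure (Vec m))) (capLayer m ρ k) ≤
      ENNReal.ofReal ((1 / 2) ^ k * (1 - ρ) * ((1 - ρ) ^ m *
        (volume : Measure (Vec m)).real (ball 0 1))) := by
  have hδ : 0 < 1 - ρ := by linarith
  rw [Measure.prod_apply_symm (measurableSet_capLayer m ρ k)]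
  calc ∫⁻ v : Vec m, volume ((fun t => (t, v)) ⁻¹' capLayer m ρ k)
      ≤ ∫⁻ v : Vec m, (ball (0 : Vec m) (1 - ρ)).indicator
          (fun _ => ENNReal.ofReal ((1 / 2) ^ k * (1 - ρ))) v := by
        refine lintegral_mono fun v => ?_
        by_cases hv : v ∈ ball (0 : Vec m) (1 - ρ)
        · rw [Set.indicator_of_mem hv]
          calc volume ((fun t => (t, v)) ⁻¹' capLayer m ρ k)
              ≤ volume (Icc (capHeight v - (1 / 2) ^ k * (1 - ρ)) (capHeight v)) := by
                refine measure_mono fun t ht => ?_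
                obtain ⟨-, -, h3, h4⟩ := ht
                simp only at h3 h4
                have : (0 : ℝ) ≤ (1 / 2) ^ (k + 1) * (1 - ρ) := by positivity
                exact ⟨by linarith, by linarith⟩
            _ = _ := by rw [Real.volume_Icc]; congr 1; ring
        · have : (fun t => (t, v)) ⁻¹' capLayer m ρ k = ∅ := by
            ext t
            simp only [mem_preimage, mem_empty_iff_false, iff_false]
            rintro ⟨h1, -⟩
            apply hv
            simp only at h1
            rw [mem_ball_zero_iff]
            linarith
          simp [this]
    _ = ENNReal.ofReal ((1 / 2) ^ k * (1 - ρ)) * volume (ball (0 : Vec m) (1 - ρ)) := by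
        rw [lintegral_indicator measurableSet_ball, setLIntegral_const]
    _ = _ := by
        rw [Measure.addHaar_ball_of_pos volume _ hδ, finrank_euclideanSpace_fin,
          ENNReal.ofReal_mul (p := (1 / 2) ^ k * (1 - ρ)) (by positivity),
          ENNReal.ofReal_mul (p := (1 - ρ) ^ m) (by positivity), Measure.real,
          ENNReal.ofReal_toReal measure_ball_lt_top.ne]

lemma exists_forall_setLIntegral_capLayer_le (m : ℕ) {K C₀ α a C₁ : ℝ} (hK : 1 ≤ K)
    (hC₀ : 1 ≤ C₀) (hα : 0 < α) (hC₁ : 0 < C₁) :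
    ∃ E : ℝ, 0 ≤ E ∧ ∀ f : Vec (m + 1) → Vec (m + 1), IsQR (m + 1) K f →
      (∀ x ∈ unitBall (m + 1), f x ≠ 0) → InMiniowitz (m + 1) C₀ α f →
      MultCond (m + 1) a C₁ f → ∀ (A : WithLp 2 (ℝ × Vec m) ≃ₗᵢ[ℝ] Vec (m + 1)) (ρ β : ℝ),
      0 ≤ ρ → ρ < 1 → ∀ k : ℕ,
      ∫⁻ p in capLayer m ρ k, logGradient (m + 1) f (axisMap A p)
          ∂((volume : Measure ℝ).prod volume) ≤
        ENNReal.ofReal ((1 - ρ) ^ m * (E * (k + 7) * (2 ^ (a - β * m)) ^ k +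
          (volume : Measure (Vec m)).real (ball 0 1) * (2 ^ (β - 1)) ^ k)) := by
  obtain ⟨E, hE0, hE⟩ := exists_forall_setLIntegral_logGradient_pow_le m (a := a) hK hC₀ hα hC₁
  refine ⟨E, hE0, fun f hQR hf0 hMin hMult A ρ β hρ0 hρ1 k => ?_⟩
  have hδ : 0 < 1 - ρ := by linarith
  set V := (volume : Measure (Vec m)).real (ball 0 1)
  have hV : 0 ≤ V := measureReal_nonneg
  have hFm := measurable_logGradient hQR.1
  have hx : axisMap A (ρ, 0) ∈ unitBall (m + 1) :=
    axisMap_mem_unitBall A (by simp) hρ0 (by simpa [capHeight] using hρ1)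
  set s : Set (Vec (m + 1)) := {y | (axisHeight A y, axisProj A y) ∈ capLayer m ρ k} with hs
  have hsm : MeasurableSet s := by
    refine measurableSet_preimage ?_ (measurableSet_capLayer m ρ k)
    exact ((continuous_axisHeight A).prodMk (lipschitzWith_axisProj A).continuous).measurable
  have hpre : axisMap A ⁻¹' s = capLayer m ρ k := by
    ext p
    simp [hs, axisHeight_axisMap, axisProj_axisMap]
  have hsprop : ∀ y ∈ s, y ∈ unitBall (m + 1) ∧
      ‖mobiusT (m + 1) (axisMap A (ρ, 0)) y‖ < 1 - (1 / 2) ^ (k + 6) := by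
    rintro y ⟨h1, h2, h3, -⟩
    simp only at h1 h2 h3
    have h0 : (0 : ℝ) ≤ (1 / 2) ^ (k + 1) * (1 - ρ) := by positivity
    rw [← axisMap_axisHeight_axisProj A y]
    exact ⟨axisMap_mem_unitBall A (by linarith) (by linarith) (by linarith),
      norm_mobiusT_axisMap_lt A hρ0 hρ1 h1.le h2.le h3⟩
  have henergy : ∫⁻ p in capLayer m ρ k, logGradient (m + 1) f (axisMap A p) ^ (m + 1)
      ∂((volume : Measure ℝ).prod volume) ≤ ENNReal.ofReal (E * ((k + 7) * (2 ^ a) ^ k)) := by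
    rw [← hpre, (measurePreserving_axisMap A).setLIntegral_comp_preimage hsm
      (hFm.pow_const (m + 1))]
    exact hE f hQR hf0 hMin hMult _ hx k s hsm (fun y hy => (hsprop y hy).1)
      fun y hy => (hsprop y hy).2
  set b : ℝ := (1 - ρ) * (2 ^ (-β)) ^ k with hb
  have hb0 : 0 < b := by positivity
  have h2β : ((2 : ℝ) ^ (-β)) ^ m * 2 ^ a = 2 ^ (a - β * m) := by
    rw [← Real.rpow_natCast, ← Real.rpow_mul (by norm_num), ← Real.rpow_add (by norm_num)]
    congr 1; ring
  have h2β' : ((2 : ℝ) ^ (-β))⁻¹ * (1 / 2) = 2 ^ (β - 1) := by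
    rw [Real.rpow_neg (by norm_num), inv_inv, Real.rpow_sub (by norm_num), Real.rpow_one]
    ring
  calc ∫⁻ p in capLayer m ρ k, logGradient (m + 1) f (axisMap A p)
          ∂((volume : Measure ℝ).prod volume)
      ≤ ∫⁻ p in capLayer m ρ k, (ENNReal.ofReal (b ^ m) *
          logGradient (m + 1) f (axisMap A p) ^ (m + 1) + ENNReal.ofReal b⁻¹)
          ∂((volume : Measure ℝ).prod volume) :=
        lintegral_mono fun p => le_mul_pow_succ_add_inv m _ hb0
    _ = ENNReal.ofReal (b ^ m) * ∫⁻ p in capLayer m ρ k,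
          logGradient (m + 1) f (axisMap A p) ^ (m + 1) ∂((volume : Measure ℝ).prod volume) +
        ENNReal.ofReal b⁻¹ *
          ((volume : Measure ℝ).prod (volume : Measure (Vec m))) (capLayer m ρ k) := by
        rw [lintegral_add_right _ measurable_const, lintegral_const_mul' _ _ ENNReal.ofReal_ne_top,
          setLIntegral_const]
    _ ≤ ENNReal.ofReal (b ^ m) * ENNReal.ofReal (E * ((k + 7) * (2 ^ a) ^ k)) +
        ENNReal.ofReal b⁻¹ * ENNReal.ofReal ((1 / 2) ^ k * (1 - ρ) * ((1 - ρ) ^ m * V)) := by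
        gcongr
        exact volume_capLayer_le m hρ1 k
    _ = ENNReal.ofReal (b ^ m * (E * ((k + 7) * (2 ^ a) ^ k)) +
          b⁻¹ * ((1 / 2) ^ k * (1 - ρ) * ((1 - ρ) ^ m * V))) := by
        rw [ENNReal.ofReal_add (by positivity) (by positivity),
          ENNReal.ofReal_mul (p := b ^ m) (by positivity),
          ENNReal.ofReal_mul (p := b⁻¹) (by positivity)]
    _ = _ := by
        congr 1
        rw [← h2β, ← h2β', hb, mul_inv]
        simp only [mul_pow, inv_pow]
        field_simp
        ring

lemma exists_forall_lintegral_cap_le {m : ℕ} (hm : 1 ≤ m) {K C₀ α a C₁ : ℝ} (hK : 1 ≤ K)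
    (hC₀ : 1 ≤ C₀) (hα : 0 < α) (ha : a < m) (hC₁ : 0 < C₁) :
    ∃ E : ℝ, 0 < E ∧ ∀ f : Vec (m + 1) → Vec (m + 1), IsQR (m + 1) K f →
      (∀ x ∈ unitBall (m + 1), f x ≠ 0) → InMiniowitz (m + 1) C₀ α f →
      MultCond (m + 1) a C₁ f → ∀ (A : WithLp 2 (ℝ × Vec m) ≃ₗᵢ[ℝ] Vec (m + 1)) (ρ : ℝ),
      0 ≤ ρ → ρ < 1 →
      ∫⁻ v in ball (0 : Vec m) ((1 - ρ) / 2), ∫⁻ t in Ioo ρ (capHeight v),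
        logGradient (m + 1) f (axisMap A (t, v)) ≤ ENNReal.ofReal (E * (1 - ρ) ^ m) := by
  obtain ⟨E, hE0, hE⟩ := exists_forall_setLIntegral_capLayer_le m (a := a) hK hC₀ hα hC₁
  have hm0 : (0 : ℝ) < m := by exact_mod_cast hm
  set V := (volume : Measure (Vec m)).real (ball 0 1)
  have hV : 0 ≤ V := measureReal_nonneg
  set β : ℝ := (a / m + 1) / 2 with hβ
  have hβ1 : β < 1 := by
    have : a / m < 1 := (div_lt_one hm0).mpr ha
    linarith
  have hβa : a - β * m < 0 := by
    have : β * m = (a + m) / 2 := by rw [hβ]; field_simp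
    linarith
  set q₁ : ℝ := 2 ^ (a - β * m)
  set q₂ : ℝ := 2 ^ (β - 1)
  have hq₁0 : 0 < q₁ := by positivity
  have hq₂0 : 0 < q₂ := by positivity
  have hq₁ : q₁ < 1 := Real.rpow_lt_one_of_one_lt_of_neg (by norm_num) hβa
  have hq₂ : q₂ < 1 := Real.rpow_lt_one_of_one_lt_of_neg (by norm_num) (by linarith)
  set u : ℕ → ℝ := fun k => E * (k + 7) * q₁ ^ k + V * q₂ ^ k with hu
  have hu0 : ∀ k, 0 ≤ u k := fun k => by positivity
  have husum : Summable u := by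
    refine Summable.add ?_ ((summable_geometric_of_lt_one hq₂0.le hq₂).mul_left V)
    have h1 : Summable fun k : ℕ => (k : ℝ) ^ 1 * q₁ ^ k :=
      summable_pow_mul_geometric_of_norm_lt_one 1 (by rwa [Real.norm_of_nonneg hq₁0.le])
    have h2 := (summable_geometric_of_lt_one hq₁0.le hq₁).mul_left 7
    refine ((h1.add h2).mul_left E).congr fun k => ?_
    ring
  refine ⟨∑' k, u k + 1, by have : 0 ≤ ∑' k, u k := tsum_nonneg hu0; linarith,
    fun f hQR hf0 hMin hMult A ρ hρ0 hρ1 => ?_⟩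
  have hδ : 0 < 1 - ρ := by linarith
  set F := fun p => logGradient (m + 1) f (axisMap A p) with hF
  have hFm : Measurable F := (measurable_logGradient hQR.1).comp (continuous_axisMap A).measurable
  set S : Set (ℝ × Vec m) := ⋃ k, capLayer m ρ k with hS
  have hSm : MeasurableSet S := MeasurableSet.iUnion fun k => measurableSet_capLayer m ρ k
  have hSmem : ∀ v ∈ ball (0 : Vec m) ((1 - ρ) / 2), ∀ t ∈ Ioo ρ (capHeight v), (t, v) ∈ S := by
    intro v hv t ht
    have h1 : 0 < (capHeight v - t) / (1 - ρ) := div_pos (by linarith [ht.2]) hδ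
    have h2 : (capHeight v - t) / (1 - ρ) ≤ 1 := by
      rw [div_le_one hδ]; linarith [ht.1, capHeight_le_one v]
    obtain ⟨k, hk1, hk2⟩ := exists_nat_pow_near_of_lt_one h1 h2
      (by norm_num : (0 : ℝ) < 1 / 2) (by norm_num)
    refine mem_iUnion.mpr ⟨k, by simpa using hv, ht.1, ?_, ?_⟩
    · exact (lt_div_iff₀ hδ).mp hk1
    · exact (div_le_iff₀ hδ).mp hk2
  calc ∫⁻ v in ball (0 : Vec m) ((1 - ρ) / 2), ∫⁻ t in Ioo ρ (capHeight v), F (t, v)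
      ≤ ∫⁻ v : Vec m, ∫⁻ t, S.indicator F (t, v) := by
        refine (setLIntegral_mono' measurableSet_ball fun v hv => ?_).trans
          (setLIntegral_le_lintegral _ _)
        rw [← lintegral_indicator measurableSet_Ioo]
        refine lintegral_mono fun t => ?_
        by_cases ht : t ∈ Ioo ρ (capHeight v)
        · simp only [Set.indicator_of_mem ht, Set.indicator_of_mem (hSmem v hv t ht), le_refl]
        · simp only [Set.indicator_of_notMem ht, zero_le]
    _ = ∫⁻ p in S, F p ∂((volume : Measure ℝ).prod volume) := by
        rw [← lintegral_indicator hSm, lintegral_prod_symm' _ (hFm.indicator hSm)]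
    _ ≤ ∑' k, ∫⁻ p in capLayer m ρ k, F p ∂((volume : Measure ℝ).prod volume) :=
        lintegral_iUnion_le _ _
    _ ≤ ∑' k, ENNReal.ofReal ((1 - ρ) ^ m * u k) :=
        ENNReal.tsum_le_tsum fun k => hE f hQR hf0 hMin hMult A ρ β hρ0 hρ1 k
    _ = ENNReal.ofReal (∑' k, (1 - ρ) ^ m * u k) :=
        (ENNReal.ofReal_tsum_of_nonneg (fun k => mul_nonneg (by positivity) (hu0 k))
          (husum.mul_left _)).symm
    _ ≤ _ := by
        refine ENNReal.ofReal_le_ofReal ?_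
        rw [tsum_mul_left, mul_comm]
        gcongr
        linarith

lemma one_sub_sq_le_capHeight {m : ℕ} {v : Vec m} (hv : ‖v‖ ≤ 1) :
    1 - ‖v‖ ^ 2 ≤ capHeight v := by
  rw [← capHeight_sq hv]
  nlinarith [capHeight_le_one v, capHeight_nonneg v]

lemma measurable_lintegral_Ioo_capHeight {m : ℕ} {F : ℝ × Vec m → ℝ≥0∞} (hF : Measurable F)
    (ρ : ℝ) : Measurable fun v => ∫⁻ t in Ioo ρ (capHeight v), F (t, v) := by
  set S : Set (ℝ × Vec m) := {p | ρ < p.1 ∧ p.1 < capHeight p.2}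
  have hS : MeasurableSet S := (measurableSet_lt measurable_const measurable_fst).inter
    (measurableSet_lt measurable_fst (continuous_capHeight.measurable.comp measurable_snd))
  have h : Measurable fun v => ∫⁻ t, S.indicator F (t, v) :=
    (hF.indicator hS).lintegral_prod_left'
  convert h using 2 with v
  rw [← lintegral_indicator measurableSet_Ioo]
  rfl

lemma exists_pos_hausdorffMeasure_eq_smul (m : ℕ) :
    ∃ s : ℝ≥0, 0 < s ∧ (μH[(m : ℝ)] : Measure (Vec m)) = s • volume :=
  ⟨_, Measure.addHaarScalarFactor_pos_of_isAddHaarMeasure _ _,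
    Measure.isAddLeftInvariant_eq_smul _ _⟩

lemma exists_forall_le_hausdorffMeasure_cap {m : ℕ} (hm : 1 ≤ m) {K C₀ α a C₁ c : ℝ} (hK : 1 ≤ K)
    (hC₀ : 1 ≤ C₀) (hα : 0 < α) (ha : a < m) (hC₁ : 0 < C₁) (hc : 0 < c) (hc2 : c ≤ 1 / 2) :
    ∃ M > 0, ∃ b > 0, ∀ f : Vec (m + 1) → Vec (m + 1), IsQR (m + 1) K f →
      (∀ x ∈ unitBall (m + 1), f x ≠ 0) → InMiniowitz (m + 1) C₀ α f →
      MultCond (m + 1) a C₁ f → ∀ (A : WithLp 2 (ℝ × Vec m) ≃ₗᵢ[ℝ] Vec (m + 1)) (ρ : ℝ),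
      0 ≤ ρ → ρ < 1 →
      ∃ G ⊆ ball (0 : Vec m) (c * (1 - ρ)), MeasurableSet G ∧
        (∀ v ∈ G, ∫⁻ t in Ioo ρ (capHeight v), logGradient (m + 1) f (axisMap A (t, v)) ≤
          ENNReal.ofReal M) ∧ ENNReal.ofReal (b * (1 - ρ) ^ m) ≤ μH[(m : ℝ)] G := by
  obtain ⟨E, hE0, hE⟩ := exists_forall_lintegral_cap_le hm (a := a) hK hC₀ hα ha hC₁
  obtain ⟨s, hs0, hs⟩ := exists_pos_hausdorffMeasure_eq_smul m
  set V := (volume : Measure (Vec m)).real (ball 0 1) with hV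
  have hVpos : 0 < V := ENNReal.toReal_pos (measure_ball_pos _ _ one_pos).ne' measure_ball_lt_top.ne
  set M := 2 * E / (c ^ m * V) with hM
  have hM0 : 0 < M := by positivity
  refine ⟨M, hM0, s * (c ^ m * V / 2), by positivity, fun f hQR hf0 hMin hMult A ρ hρ0 hρ1 => ?_⟩
  have hδ : 0 < 1 - ρ := by linarith
  set I : Vec m → ℝ≥0∞ := fun v =>
    ∫⁻ t in Ioo ρ (capHeight v), logGradient (m + 1) f (axisMap A (t, v))
  have hI : Measurable I := measurable_lintegral_Ioo_capHeight
    ((measurable_logGradient hQR.1).comp (continuous_axisMap A).measurable) ρ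
  set D := ball (0 : Vec m) (c * (1 - ρ))
  have hD : volume D = ENNReal.ofReal (c ^ m * V * (1 - ρ) ^ m) := by
    rw [Measure.addHaar_ball_of_pos volume _ (by positivity), finrank_euclideanSpace_fin,
      mul_pow, mul_right_comm, ENNReal.ofReal_mul (p := c ^ m * (1 - ρ) ^ m) (by positivity), hV,
      Measure.real, ENNReal.ofReal_toReal measure_ball_lt_top.ne]
  have hDsub : D ⊆ ball (0 : Vec m) ((1 - ρ) / 2) := ball_subset_ball (by nlinarith)
  have hbad : volume (D ∩ {v | ENNReal.ofReal M ≤ I v}) ≤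
      ENNReal.ofReal (c ^ m * V * (1 - ρ) ^ m / 2) := by
    have h1 : ENNReal.ofReal M * volume (D ∩ {v | ENNReal.ofReal M ≤ I v}) ≤
        ENNReal.ofReal (E * (1 - ρ) ^ m) := by
      calc ENNReal.ofReal M * volume (D ∩ {v | ENNReal.ofReal M ≤ I v})
          = ENNReal.ofReal M * (volume.restrict D) {v | ENNReal.ofReal M ≤ I v} := by
            rw [Measure.restrict_apply (measurableSet_le measurable_const hI), inter_comm]
        _ ≤ ∫⁻ v in D, I v := mul_meas_ge_le_lintegral hI _
        _ ≤ ∫⁻ v in ball (0 : Vec m) ((1 - ρ) / 2), I v := lintegral_mono_set hDsub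
        _ ≤ _ := hE f hQR hf0 hMin hMult A ρ hρ0 hρ1
    have h2 : E * (1 - ρ) ^ m = M * (c ^ m * V * (1 - ρ) ^ m / 2) := by
      rw [hM]; field_simp
    rw [h2, ENNReal.ofReal_mul hM0.le] at h1
    exact (ENNReal.mul_le_mul_iff_right (ENNReal.ofReal_pos.mpr hM0).ne'
      ENNReal.ofReal_ne_top).mp h1
  have hGm : MeasurableSet (D ∩ {v | I v ≤ ENNReal.ofReal M}) :=
    measurableSet_ball.inter (measurableSet_le hI measurable_const)
  refine ⟨D ∩ {v | I v ≤ ENNReal.ofReal M}, inter_subset_left, hGm, fun v hv => hv.2, ?_⟩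
  have hG : ENNReal.ofReal (c ^ m * V * (1 - ρ) ^ m / 2) ≤
      volume (D ∩ {v | I v ≤ ENNReal.ofReal M}) := by
    have h1 : volume D ≤ volume (D ∩ {v | I v ≤ ENNReal.ofReal M}) +
        ENNReal.ofReal (c ^ m * V * (1 - ρ) ^ m / 2) := by
      refine le_trans (le_trans (measure_mono ?_) (measure_union_le _ _)) (by gcongr)
      intro v hv
      rcases le_total (I v) (ENNReal.ofReal M) with h | h
      · exact Or.inl ⟨hv, h⟩
      · exact Or.inr ⟨hv, h⟩
    rw [hD] at h1
    have h2 : ENNReal.ofReal (c ^ m * V * (1 - ρ) ^ m) =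
        ENNReal.ofReal (c ^ m * V * (1 - ρ) ^ m / 2) +
        ENNReal.ofReal (c ^ m * V * (1 - ρ) ^ m / 2) := by
      rw [← ENNReal.ofReal_add (by positivity) (by positivity), add_halves]
    rw [h2] at h1
    exact (ENNReal.add_le_add_iff_right ENNReal.ofReal_ne_top).mp h1
  have h3 : (s : ℝ) * (c ^ m * V / 2) * (1 - ρ) ^ m = s * (c ^ m * V * (1 - ρ) ^ m / 2) := by ring
  rw [hs, h3, ENNReal.ofReal_mul s.coe_nonneg, ENNReal.ofReal_coe_nnreal]
  simp only [Measure.smul_apply, ENNReal.smul_def, smul_eq_mul]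
  gcongr

lemma le_norm_axisMap_of_lintegral_le {m : ℕ} {C₀ α M : ℝ} (hC₀ : 1 ≤ C₀) (hα : 0 < α)
    (hM : 0 ≤ M) {f : Vec (m + 1) → Vec (m + 1)}
    (hf : ∀ x ∈ unitBall (m + 1), DifferentiableAt ℝ f x)
    (hf0 : ∀ x ∈ unitBall (m + 1), f x ≠ 0) (hMin : InMiniowitz (m + 1) C₀ α f)
    (A : WithLp 2 (ℝ × Vec m) ≃ₗᵢ[ℝ] Vec (m + 1)) {ρ : ℝ} (hρ0 : 0 ≤ ρ) (hρ1 : ρ < 1) {v : Vec m}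
    (hv : ‖v‖ ≤ (1 - ρ) / 2) (hint : ∫⁻ t in Ioo ρ (capHeight v),
      logGradient (m + 1) f (axisMap A (t, v)) ≤ ENNReal.ofReal M) {t : ℝ}
    (ht : t ∈ Ico ρ (capHeight v)) :
    ‖f (axisMap A (ρ, 0))‖ * (C₀⁻¹ * (1 / 127) ^ α) * Real.exp (-M) ≤ ‖f (axisMap A (t, v))‖ := by
  have hv1 : ‖v‖ ≤ 1 := by linarith
  have hv0 := norm_nonneg v
  have hx : axisMap A (ρ, 0) ∈ unitBall (m + 1) :=
    axisMap_mem_unitBall A (by simp) hρ0 (by simpa [capHeight] using hρ1)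
  have hmem : ∀ s ∈ Ico ρ (capHeight v), axisMap A (s, v) ∈ unitBall (m + 1) := fun s hs =>
    axisMap_mem_unitBall A hv1 (hρ0.trans hs.1) hs.2
  have hτ := one_sub_sq_le_capHeight hv1
  have hT : ‖mobiusT (m + 1) (axisMap A (ρ, 0)) (axisMap A (ρ, v))‖ < 1 - (1 / 2) ^ (0 + 6) := by
    refine norm_mobiusT_axisMap_lt A hρ0 hρ1 hv le_rfl ?_
    rw [zero_add, pow_one]
    have : ‖v‖ ^ 2 ≤ (1 - ρ) / 4 := by nlinarith
    linarith
  have h1 := (norm_mem_Icc_of_inMiniowitz hC₀ hα hf0 hMin hx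
    (hmem ρ ⟨le_rfl, ht.1.trans_lt ht.2⟩) (by norm_num) hT.le).1
  norm_num at h1
  have hsub : Ioc ρ t ⊆ Ioo ρ (capHeight v) := fun s hs => ⟨hs.1, hs.2.trans_lt ht.2⟩
  have he : ‖axisMap A ((1 : ℝ), (0 : Vec m))‖ = 1 := by
    have h := norm_sq_axisMap A ((1 : ℝ), (0 : Vec m))
    rw [← pow_left_inj₀ (norm_nonneg _) zero_le_one two_ne_zero, h]
    simp
  refine le_trans ?_ (norm_mul_exp_neg_le_of_lintegral_le (p := fun s => axisMap A (s, v)) hf hf0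
    he ht.1 hM (fun s _ => hasDerivAt_axisMap A s v)
    (fun s hs => hmem s ⟨hs.1, hs.2.trans_lt ht.2⟩) ((lintegral_mono_set hsub).trans hint))
  gcongr

lemma le_norm_of_hasNTLimit {m : ℕ} {κ L ρ : ℝ} {f : Vec (m + 1) → Vec (m + 1)}
    (A : WithLp 2 (ℝ × Vec m) ≃ₗᵢ[ℝ] Vec (m + 1)) {v : Vec m} {w : Vec (m + 1)} (hv : ‖v‖ ≤ 1)
    (hρ0 : 0 ≤ ρ) (hρ : ρ < capHeight v) (hκ : 0 < κ) (hvκ : 1 < (1 + κ) * capHeight v)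
    (hL : ∀ t ∈ Ico ρ (capHeight v), L ≤ ‖f (axisMap A (t, v))‖)
    (hw : HasNTLimit (m + 1) κ f (axisMap A (capHeight v, v)) w) : L ≤ ‖w‖ := by
  set τ := capHeight v
  have hIoo : ∀ᶠ t in 𝓝[<] τ, t ∈ Ioo ρ τ := Ioo_mem_nhdsLT hρ
  have hτκ : ∀ᶠ t in 𝓝[<] τ, 2 < (1 + κ) * (τ + t) := by
    have hc : Continuous fun t : ℝ => (1 + κ) * (τ + t) := by fun_prop
    refine (hc.continuousAt.eventually (lt_mem_nhds ?_)).filter_mono nhdsWithin_le_nhds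
    linarith
  have hnt : ∀ᶠ t in 𝓝[<] τ, axisMap A (t, v) ∈ ntRegion (m + 1) κ (axisMap A (τ, v)) := by
    filter_upwards [hIoo, hτκ] with t ht htκ
    have hB := axisMap_mem_unitBall A hv (hρ0.trans ht.1.le) ht.2
    refine ⟨hB, ?_⟩
    have hd : ‖axisMap A (t, v) - axisMap A (τ, v)‖ = τ - t := by
      have h := norm_sq_axisMap A ((t, v) - (τ, v))
      rw [← axisMap_sub] at h
      simp only [Prod.fst_sub, Prod.snd_sub, sub_self, norm_zero] at h
      rw [← pow_left_inj₀ (norm_nonneg _) (by linarith [ht.2]) two_ne_zero, h]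
      ring
    have h2 := norm_sq_axisMap A (t, v)
    have h3 := capHeight_sq hv
    have h4 : ‖axisMap A (t, v)‖ < 1 := by simpa [unitBall] using hB
    simp only at h2
    rw [hd]
    set z := ‖axisMap A (t, v)‖
    have h5 : (τ - t) * (τ + t) = (1 - z) * (1 + z) := by linear_combination h3 + h2
    have h6 : (τ - t) * (τ + t) ≤ 2 * (1 - z) := by rw [h5]; nlinarith
    have h7 : (τ - t) * 2 < (τ - t) * ((1 + κ) * (τ + t)) :=
      mul_lt_mul_of_pos_left htκ (by linarith [ht.2])
    nlinarith
  have htend : Tendsto (fun t => axisMap A (t, v)) (𝓝[<] τ) (𝓝 (axisMap A (τ, v))) :=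
    ((hasDerivAt_axisMap A τ v).continuousAt.tendsto).mono_left nhdsWithin_le_nhds
  have hlim := (hw.comp (tendsto_nhdsWithin_iff.mpr ⟨htend, hnt⟩)).norm
  refine ge_of_tendsto hlim ?_
  filter_upwards [hIoo] with t ht using hL t ⟨ht.1.le, ht.2⟩

/-- The part of the upper unit hemisphere lying above `G`. -/
def capOver {m : ℕ} (A : WithLp 2 (ℝ × Vec m) ≃ₗᵢ[ℝ] Vec (m + 1)) (G : Set (Vec m)) :
    Set (Vec (m + 1)) :=
  {ω ∈ unitSphere (m + 1) | axisProj A ω ∈ G ∧ 0 ≤ axisHeight A ω}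

lemma measurableSet_capOver {m : ℕ} (A : WithLp 2 (ℝ × Vec m) ≃ₗᵢ[ℝ] Vec (m + 1))
    {G : Set (Vec m)} (hG : MeasurableSet G) : MeasurableSet (capOver A G) :=
  isClosed_sphere.measurableSet.inter (((lipschitzWith_axisProj A).continuous.measurable hG).inter
    (measurableSet_le measurable_const (continuous_axisHeight A).measurable))

lemma eq_axisMap_of_mem_capOver {m : ℕ} {A : WithLp 2 (ℝ × Vec m) ≃ₗᵢ[ℝ] Vec (m + 1)}
    {G : Set (Vec m)} {ω : Vec (m + 1)} (hω : ω ∈ capOver A G) :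
    axisMap A (capHeight (axisProj A ω), axisProj A ω) = ω := by
  have h1 : ‖ω‖ = 1 := by simpa [unitSphere] using hω.1
  have h2 := norm_sq_eq_axis A ω
  have h3 : capHeight (axisProj A ω) = axisHeight A ω := by
    rw [capHeight, Real.sqrt_eq_iff_mul_self_eq]
    · rw [h1] at h2; linarith
    · rw [h1] at h2; nlinarith [sq_nonneg (axisHeight A ω)]
    · exact hω.2.2
  rw [h3, axisMap_axisHeight_axisProj]

lemma axisMap_capHeight_mem_unitSphere {m : ℕ} (A : WithLp 2 (ℝ × Vec m) ≃ₗᵢ[ℝ] Vec (m + 1))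
    {v : Vec m} (hv : ‖v‖ ≤ 1) : axisMap A (capHeight v, v) ∈ unitSphere (m + 1) := by
  have h := norm_sq_axisMap A (capHeight v, v)
  simp only [capHeight_sq hv, sub_add_cancel] at h
  have h1 : ‖axisMap A (capHeight v, v)‖ = 1 := by
    rw [← pow_left_inj₀ (norm_nonneg _) zero_le_one two_ne_zero, h, one_pow]
  simpa [unitSphere] using h1

lemma sphMeasure_succ (m : ℕ) :
    sphMeasure (m + 1) = (μH[(m : ℝ)]).restrict (unitSphere (m + 1)) := by
  rw [sphMeasure]
  congr 2
  push_cast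
  ring

lemma hausdorffMeasure_le_sphMeasure_capOver {m : ℕ}
    (A : WithLp 2 (ℝ × Vec m) ≃ₗᵢ[ℝ] Vec (m + 1)) {G : Set (Vec m)} (hG : G ⊆ ball 0 1) :
    μH[(m : ℝ)] G ≤ sphMeasure (m + 1) (capOver A G) := by
  have hsub : G ⊆ axisProj A '' capOver A G := by
    intro v hv
    have hv1 : ‖v‖ ≤ 1 := by simpa using (mem_ball_zero_iff.mp (hG hv)).le
    refine ⟨axisMap A (capHeight v, v), ⟨axisMap_capHeight_mem_unitSphere A hv1, ?_, ?_⟩,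
      axisProj_axisMap A _⟩
    · rwa [axisProj_axisMap]
    · rw [axisHeight_axisMap]
      exact capHeight_nonneg v
  calc μH[(m : ℝ)] G ≤ μH[(m : ℝ)] (axisProj A '' capOver A G) := measure_mono hsub
    _ ≤ μH[(m : ℝ)] (capOver A G) := by
        simpa using (lipschitzWith_axisProj A).hausdorffMeasure_image_le m.cast_nonneg
          (capOver A G)
    _ ≤ _ := by
        rw [sphMeasure_succ]
        rw [Measure.restrict_eq_self _ (fun ω hω => hω.1)]

lemma exists_axisMap_eq {m : ℕ} (x : Vec (m + 1)) :
    ∃ A : WithLp 2 (ℝ × Vec m) ≃ₗᵢ[ℝ] Vec (m + 1), axisMap A (‖x‖, 0) = x := by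
  have he : ∃ e : Vec (m + 1), ‖e‖ = 1 ∧ ‖x‖ • e = x := by
    by_cases hx : x = 0
    · exact ⟨EuclideanSpace.single 0 1, by simp, by simp [hx]⟩
    · have : ‖x‖ ≠ 0 := norm_ne_zero_iff.mpr hx
      exact ⟨‖x‖⁻¹ • x, by simp [norm_smul, this], by simp [smul_smul, this]⟩
  obtain ⟨e, he1, hex⟩ := he
  obtain ⟨A, hA⟩ := exists_linearIsometryEquiv_prod m he1
  refine ⟨A, ?_⟩
  have h0 : axisMap A (0, 0) = 0 := by simp [axisMap]
  rw [axisMap_eq, h0, add_zero, axisMap, hA, hex]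

lemma exists_forall_le_setLIntegral_shadow {m : ℕ} (hm : 1 ≤ m) {K C₀ α a C₁ κ q : ℝ}
    (hK : 1 ≤ K) (hC₀ : 1 ≤ C₀) (hα : 0 < α) (ha : a < m) (hC₁ : 0 < C₁) (hκ : 0 < κ)
    (hq : 0 < q) :
    ∃ b > 0, ∀ f : Vec (m + 1) → Vec (m + 1), IsQR (m + 1) K f →
      (∀ x ∈ unitBall (m + 1), f x ≠ 0) → InMiniowitz (m + 1) C₀ α f →
      MultCond (m + 1) a C₁ f → ∀ g : Vec (m + 1) → Vec (m + 1),
      (∀ᵐ ω ∂(sphMeasure (m + 1)), HasNTLimit (m + 1) κ f ω (g ω)) → ∀ x ∈ unitBall (m + 1),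
      ENNReal.ofReal (b * ‖f x‖ ^ q * (1 - ‖x‖) ^ m) ≤
        ∫⁻ ω in {ω ∈ unitSphere (m + 1) | x ∈ ntRegion (m + 1) κ ω},
          ENNReal.ofReal (‖g ω‖ ^ q) ∂(sphMeasure (m + 1)) := by
  set c : ℝ := κ / (2 * (1 + κ)) with hc
  have hcpos : 0 < c := by positivity
  have hcmul : c * (2 * (1 + κ)) = κ := by rw [hc]; field_simp
  have hc2 : c ≤ 1 / 2 := by nlinarith
  have hcκ : c < κ := by nlinarith
  obtain ⟨M, hM0, b, hb0, hb⟩ :=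
    exists_forall_le_hausdorffMeasure_cap hm (a := a) hK hC₀ hα ha hC₁ hcpos hc2
  set c₂ : ℝ := C₀⁻¹ * (1 / 127) ^ α * Real.exp (-M) with hc₂
  have hC₀' : 0 < C₀ := by linarith
  have hc₂0 : 0 < c₂ := by positivity
  refine ⟨c₂ ^ q * b, by positivity, fun f hQR hf0 hMin hMult g hg x hx => ?_⟩
  obtain ⟨A, hA⟩ := exists_axisMap_eq x
  have hρ0 := norm_nonneg x
  have hρ1 : ‖x‖ < 1 := by simpa [unitBall] using hx
  obtain ⟨G, hGsub, hGm, hGint, hGle⟩ := hb f hQR hf0 hMin hMult A ‖x‖ hρ0 hρ1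
  set ρ := ‖x‖
  have hδ : 0 < 1 - ρ := by linarith
  have hGnorm : ∀ v ∈ G, ‖v‖ < c * (1 - ρ) := fun v hv => mem_ball_zero_iff.mp (hGsub hv)
  have hcap : ∀ v ∈ G, 1 - c ^ 2 * (1 - ρ) ^ 2 < capHeight v := by
    intro v hv
    have h1 := hGnorm v hv
    have h2 := one_sub_sq_le_capHeight (v := v) (by nlinarith)
    have h3 : ‖v‖ ^ 2 < (c * (1 - ρ)) ^ 2 := by gcongr
    rw [mul_pow] at h3
    linarith
  have hρcap : ∀ v ∈ G, ρ < capHeight v := by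
    intro v hv
    have h1 := hcap v hv
    have h2 : c ^ 2 * (1 - ρ) ^ 2 ≤ 1 * (1 - ρ) := by
      gcongr
      · nlinarith
      · nlinarith
    linarith
  have hsub : capOver A G ⊆ {ω ∈ unitSphere (m + 1) | x ∈ ntRegion (m + 1) κ ω} := by
    intro ω hω
    refine ⟨hω.1, hx, ?_⟩
    have hv := hω.2.1
    have h1 := hGnorm _ hv
    have h2 := hρcap _ hv
    have h3 := capHeight_le_one (axisProj A ω)
    have hd : ‖x - ω‖ ^ 2 =
        (ρ - capHeight (axisProj A ω)) ^ 2 + ‖axisProj A ω‖ ^ 2 := by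
      conv_lhs => rw [← eq_axisMap_of_mem_capOver hω, ← hA, axisMap_sub, norm_sq_axisMap]
      simp
    have h4 : (ρ - capHeight (axisProj A ω)) ^ 2 ≤ (1 - ρ) ^ 2 := by
      rw [← neg_sq]
      exact pow_le_pow_left₀ (by linarith) (by linarith) 2
    have h5 : ‖axisProj A ω‖ ^ 2 < (c * (1 - ρ)) ^ 2 :=
      pow_lt_pow_left₀ h1 (norm_nonneg _) two_ne_zero
    refine lt_of_pow_lt_pow_left₀ 2 (by positivity) ?_
    have h6 : (1 - ρ) ^ 2 + (c * (1 - ρ)) ^ 2 ≤ ((1 + κ) * (1 - ρ)) ^ 2 := by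
      have : 1 + c ^ 2 ≤ (1 + κ) ^ 2 := by nlinarith
      calc (1 - ρ) ^ 2 + (c * (1 - ρ)) ^ 2 = (1 + c ^ 2) * (1 - ρ) ^ 2 := by ring
        _ ≤ (1 + κ) ^ 2 * (1 - ρ) ^ 2 := by gcongr
        _ = _ := by ring
    linarith
  have hlow : ∀ᵐ ω ∂(sphMeasure (m + 1)), ω ∈ capOver A G → ‖f x‖ * c₂ ≤ ‖g ω‖ := by
    filter_upwards [hg] with ω hgω hω
    have hv := hω.2.1
    have h1 := hGnorm _ hv
    have hv2 : ‖axisProj A ω‖ ≤ (1 - ρ) / 2 := by nlinarith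
    have hNT : HasNTLimit (m + 1) κ f
        (axisMap A (capHeight (axisProj A ω), axisProj A ω)) (g ω) := by
      rwa [eq_axisMap_of_mem_capOver hω]
    refine le_norm_of_hasNTLimit A (by linarith) hρ0 (hρcap _ hv) hκ ?_ (fun t ht => ?_) hNT
    · have h2 := hcap _ hv
      have h3 : c ^ 2 * (1 - ρ) ^ 2 ≤ c * 1 := by
        rw [sq c]
        gcongr
        · nlinarith
        · nlinarith
      nlinarith
    · have := le_norm_axisMap_of_lintegral_le hC₀ hα hM0.le hQR.2.1 hf0 hMin A hρ0 hρ1 hv2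
        (hGint _ hv) ht
      rw [hA] at this
      rwa [hc₂, ← mul_assoc]
  have hGball : G ⊆ ball 0 1 := fun v hv => by
    rw [mem_ball_zero_iff]
    have := hGnorm v hv
    nlinarith
  calc ENNReal.ofReal (c₂ ^ q * b * ‖f x‖ ^ q * (1 - ρ) ^ m)
      = ENNReal.ofReal ((‖f x‖ * c₂) ^ q) * ENNReal.ofReal (b * (1 - ρ) ^ m) := by
        rw [← ENNReal.ofReal_mul (by positivity), Real.mul_rpow (norm_nonneg _) hc₂0.le]
        congr 1
        ring
    _ ≤ ENNReal.ofReal ((‖f x‖ * c₂) ^ q) * sphMeasure (m + 1) (capOver A G) := by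
        gcongr
        exact hGle.trans (hausdorffMeasure_le_sphMeasure_capOver A hGball)
    _ = ∫⁻ _ in capOver A G, ENNReal.ofReal ((‖f x‖ * c₂) ^ q) ∂(sphMeasure (m + 1)) := by
        rw [setLIntegral_const]
    _ ≤ ∫⁻ ω in capOver A G, ENNReal.ofReal (‖g ω‖ ^ q) ∂(sphMeasure (m + 1)) := by
        refine lintegral_mono_ae ?_
        rw [ae_restrict_iff' (measurableSet_capOver A hGm)]
        filter_upwards [hlow] with ω hω hmem
        have := hω hmem
        gcongr
    _ ≤ _ := lintegral_mono_set hsub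

lemma lipschitzOnWith_capHeight_graph {m : ℕ} (A : WithLp 2 (ℝ × Vec m) ≃ₗᵢ[ℝ] Vec (m + 1)) :
    LipschitzOnWith 2 (fun v => axisMap A (capHeight v, v)) (ball (0 : Vec m) (1 / 2)) := by
  refine LipschitzOnWith.of_dist_le_mul fun v hv w hw => ?_
  rw [mem_ball_zero_iff] at hv hw
  have h := norm_sq_axisMap A ((capHeight v, v) - (capHeight w, w))
  rw [← axisMap_sub] at h
  simp only [Prod.fst_sub, Prod.snd_sub] at h
  have hv1 := half_le_capHeight hv.le
  have hw1 := half_le_capHeight hw.le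
  have hv2 := capHeight_sq (v := v) (by linarith)
  have hw2 := capHeight_sq (v := w) (by linarith)
  have hnn : |‖v‖ - ‖w‖| ≤ ‖v - w‖ := abs_norm_sub_norm_le v w
  have hprod : (capHeight v - capHeight w) * (capHeight v + capHeight w) =
      (‖w‖ - ‖v‖) * (‖v‖ + ‖w‖) := by linear_combination hv2 - hw2
  have habs : |capHeight v - capHeight w| ≤ ‖v - w‖ := by
    calc |capHeight v - capHeight w|
        ≤ |capHeight v - capHeight w| * (capHeight v + capHeight w) :=
          le_mul_of_one_le_right (abs_nonneg _) (by linarith)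
      _ = |‖w‖ - ‖v‖| * (‖v‖ + ‖w‖) := by
          rw [← abs_of_nonneg (by linarith : 0 ≤ capHeight v + capHeight w), ← abs_mul, hprod,
            abs_mul, abs_of_nonneg (by positivity : 0 ≤ ‖v‖ + ‖w‖)]
      _ ≤ |‖w‖ - ‖v‖| * 1 := by gcongr; linarith
      _ ≤ ‖v - w‖ := by rwa [mul_one, abs_sub_comm]
  have hsq : (capHeight v - capHeight w) ^ 2 ≤ ‖v - w‖ ^ 2 := by
    rw [← sq_abs]
    gcongr
  rw [dist_eq_norm, dist_eq_norm, NNReal.coe_ofNat]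
  refine le_of_sq_le_sq ?_ (by positivity)
  nlinarith [sq_nonneg ‖v - w‖]

lemma exists_pos_forall_hausdorffMeasure_ball_eq (m : ℕ) :
    ∃ B > 0, ∀ r > 0, μH[(m : ℝ)] (ball (0 : Vec m) r) = ENNReal.ofReal (B * r ^ m) := by
  obtain ⟨s, hs0, hs⟩ := exists_pos_hausdorffMeasure_eq_smul m
  have hV : 0 < (volume : Measure (Vec m)).real (ball 0 1) :=
    ENNReal.toReal_pos (measure_ball_pos _ _ one_pos).ne' measure_ball_lt_top.ne
  refine ⟨s * (volume : Measure (Vec m)).real (ball 0 1), by positivity, fun r hr => ?_⟩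
  rw [hs, mul_right_comm, ENNReal.ofReal_mul (by positivity), ENNReal.ofReal_mul (by positivity),
    ENNReal.ofReal_coe_nnreal, Measure.real, ENNReal.ofReal_toReal measure_ball_lt_top.ne,
    Measure.smul_apply, Measure.addHaar_ball_of_pos volume _ hr, finrank_euclideanSpace_fin,
    ENNReal.smul_def, smul_eq_mul, mul_assoc]

lemma sphMeasure_ball_le {m : ℕ} {e : Vec (m + 1)} (he : ‖e‖ = 1) {r : ℝ} (hr : r ≤ 1 / 2) :
    sphMeasure (m + 1) (ball e r) ≤ 2 ^ m * μH[(m : ℝ)] (ball (0 : Vec m) r) := by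
  obtain ⟨A, hA⟩ := exists_axisMap_eq e
  rw [he] at hA
  have hsub : ball e r ∩ unitSphere (m + 1) ⊆
      (fun v => axisMap A (capHeight v, v)) '' ball (0 : Vec m) r := by
    rintro ω ⟨hω, hωS⟩
    have h1 : ‖ω - e‖ < r := mem_ball_iff_norm.mp hω
    have h2 := norm_sq_eq_axis A (ω - e)
    have h3 : axisProj A (ω - e) = axisProj A ω := by
      have : axisProj A e = 0 := by rw [← hA, axisProj_axisMap]
      rw [← sub_zero (axisProj A ω), ← this]
      simp [axisProj]
    have h4 : axisHeight A (ω - e) = axisHeight A ω - 1 := by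
      have : axisHeight A e = 1 := by rw [← hA, axisHeight_axisMap]
      rw [← this]
      simp [axisHeight]
    rw [h3, h4] at h2
    have h5 : ‖ω - e‖ ^ 2 < r ^ 2 := by gcongr
    have hr0 : 0 < r := (norm_nonneg _).trans_lt h1
    have hproj : axisProj A ω ∈ ball (0 : Vec m) r := by
      rw [mem_ball_zero_iff]
      refine lt_of_pow_lt_pow_left₀ 2 hr0.le ?_
      linarith [sq_nonneg (axisHeight A ω - 1)]
    have hheight : 0 ≤ axisHeight A ω := by
      by_contra! h
      nlinarith [sq_nonneg ‖axisProj A ω‖]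
    exact ⟨axisProj A ω, hproj,
      eq_axisMap_of_mem_capOver (G := ball (0 : Vec m) r) ⟨hωS, hproj, hheight⟩⟩
  rw [sphMeasure_succ, Measure.restrict_apply measurableSet_ball]
  refine (measure_mono hsub).trans ?_
  have := ((lipschitzOnWith_capHeight_graph A).mono
    (ball_subset_ball hr)).hausdorffMeasure_image_le m.cast_nonneg
  simpa using this

lemma sphMeasure_unitSphere_lt_top (m : ℕ) : sphMeasure (m + 1) (unitSphere (m + 1)) < ∞ := by
  obtain ⟨B, -, hB⟩ := exists_pos_forall_hausdorffMeasure_ball_eq m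
  refine (isCompact_sphere (0 : Vec (m + 1)) 1).measure_lt_top_of_nhdsWithin fun e he => ?_
  have he1 : ‖e‖ = 1 := by simpa using he
  refine ⟨ball e (1 / 2), mem_nhdsWithin_of_mem_nhds (ball_mem_nhds e (by norm_num)), ?_⟩
  refine (sphMeasure_ball_le he1 le_rfl).trans_lt ?_
  rw [hB _ (by norm_num)]
  exact ENNReal.mul_lt_top (by simp) ENNReal.ofReal_lt_top

lemma exists_forall_sphMeasure_shadow_le (m : ℕ) {κ : ℝ} (hκ : 0 < κ) :
    ∃ C > 0, ∀ x ∈ unitBall (m + 1),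
      sphMeasure (m + 1) {ω ∈ unitSphere (m + 1) | x ∈ ntRegion (m + 1) κ ω} ≤
        ENNReal.ofReal (C * (1 - ‖x‖) ^ m) := by
  obtain ⟨B, hB0, hB⟩ := exists_pos_forall_hausdorffMeasure_ball_eq m
  have hfin := sphMeasure_unitSphere_lt_top m
  set T := (sphMeasure (m + 1)).real (unitSphere (m + 1)) with hT
  have hT0 : 0 ≤ T := measureReal_nonneg
  refine ⟨2 ^ m * B * (2 + κ) ^ m + T * (2 * (2 + κ)) ^ m, by positivity, fun x hx => ?_⟩
  have hx1 : ‖x‖ < 1 := by simpa [unitBall] using hx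
  have hδ : 0 < 1 - ‖x‖ := by linarith
  set δ := 1 - ‖x‖ with hδdef
  rw [add_mul]
  rcases le_or_gt ((2 + κ) * δ) (1 / 2) with h | h
  · obtain ⟨A, hA⟩ := exists_axisMap_eq x
    set e := axisMap A ((1 : ℝ), (0 : Vec m)) with he
    have he1 : ‖e‖ = 1 := by
      have h := norm_sq_axisMap A ((1 : ℝ), (0 : Vec m))
      rw [← pow_left_inj₀ (norm_nonneg _) zero_le_one two_ne_zero, h]
      simp
    have hxe : ‖x - e‖ = δ := by
      rw [← pow_left_inj₀ (norm_nonneg _) hδ.le two_ne_zero]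
      conv_lhs => rw [← hA, he, axisMap_sub, norm_sq_axisMap]
      simp only [Prod.fst_sub, Prod.snd_sub, sub_self, norm_zero, hδdef]
      ring
    have hsub : {ω ∈ unitSphere (m + 1) | x ∈ ntRegion (m + 1) κ ω} ⊆ ball e ((2 + κ) * δ) := by
      rintro ω ⟨-, -, hω⟩
      rw [mem_ball_iff_norm]
      calc ‖ω - e‖ ≤ ‖ω - x‖ + ‖x - e‖ := norm_sub_le_norm_sub_add_norm_sub _ _ _
        _ < (1 + κ) * δ + δ := by rw [hxe, norm_sub_rev]; gcongr
        _ = _ := by ring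
    calc _ ≤ sphMeasure (m + 1) (ball e ((2 + κ) * δ)) := measure_mono hsub
      _ ≤ 2 ^ m * μH[(m : ℝ)] (ball (0 : Vec m) ((2 + κ) * δ)) := sphMeasure_ball_le he1 h
      _ = ENNReal.ofReal (2 ^ m * B * (2 + κ) ^ m * δ ^ m) := by
        rw [hB _ (by positivity), ← ENNReal.ofReal_ofNat, ← ENNReal.ofReal_pow (by norm_num),
          ← ENNReal.ofReal_mul (by positivity), mul_pow]
        congr 1
        ring
      _ ≤ _ := ENNReal.ofReal_le_ofReal (le_add_of_nonneg_right (by positivity))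
  · have h1 : T ≤ T * (2 * (2 + κ)) ^ m * δ ^ m := by
      rw [mul_assoc, ← mul_pow]
      exact le_mul_of_one_le_right hT0 (one_le_pow₀ (by linarith))
    calc _ ≤ sphMeasure (m + 1) (unitSphere (m + 1)) := measure_mono fun ω hω => hω.1
      _ = ENNReal.ofReal T := by rw [hT, Measure.real, ENNReal.ofReal_toReal hfin.ne]
      _ ≤ _ := ENNReal.ofReal_le_ofReal
        (h1.trans (le_add_of_nonneg_left (by positivity)))

theorem submean_value_on_shadow (n : ℕ) (hn : 2 ≤ n) (K C₀ α a C₁ κ q : ℝ)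
    (hK : 1 ≤ K) (hC₀ : 1 ≤ C₀) (hα : 0 < α) (ha0 : 0 ≤ a) (ha : a < (n : ℝ) - 1)
    (hC₁ : 0 < C₁) (hκ : 0 < κ) (hq : 0 < q) :
    ∃ C : ℝ, 0 < C ∧ ∀ f : Vec n → Vec n,
      IsQR n K f → (∀ x ∈ unitBall n, f x ≠ 0) →
      InMiniowitz n C₀ α f → MultCond n a C₁ f →
      ∀ g : Vec n → Vec n, (∀ᵐ ω ∂(sphMeasure n), HasNTLimit n κ f ω (g ω)) →
        ∀ x ∈ unitBall n,
          ENNReal.ofReal (‖f x‖ ^ q) ≤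
            ENNReal.ofReal C * ((sphMeasure n {ω ∈ unitSphere n | x ∈ ntRegion n κ ω})⁻¹ *
              ∫⁻ ω in {ω ∈ unitSphere n | x ∈ ntRegion n κ ω},
                ENNReal.ofReal (‖g ω‖ ^ q) ∂(sphMeasure n)) := by
  obtain ⟨m, rfl⟩ : ∃ m, n = m + 1 := ⟨n - 1, by omega⟩
  have ha' : a < m := by push_cast at ha; linarith
  obtain ⟨b, hb0, hb⟩ := exists_forall_le_setLIntegral_shadow (m := m) (by omega) (a := a) hK hC₀
    hα ha' hC₁ hκ hq
  obtain ⟨D, hD0, hD⟩ := exists_forall_sphMeasure_shadow_le m hκ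
  refine ⟨D / b, by positivity, fun f hQR hf0 hMin hMult g hg x hx => ?_⟩
  have hx1 : ‖x‖ < 1 := by simpa [unitBall] using hx
  have hδ : 0 < 1 - ‖x‖ := by linarith
  calc ENNReal.ofReal (‖f x‖ ^ q)
      = ENNReal.ofReal (D / b) * ((ENNReal.ofReal (D * (1 - ‖x‖) ^ m))⁻¹ *
          ENNReal.ofReal (b * ‖f x‖ ^ q * (1 - ‖x‖) ^ m)) := by
        rw [← ENNReal.ofReal_inv_of_pos (by positivity), ← ENNReal.ofReal_mul (by positivity),
          ← ENNReal.ofReal_mul (by positivity)]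
        congr 1
        field_simp
    _ ≤ _ := by
        gcongr
        · exact hD x hx
        · exact hb f hQR hf0 hMin hMult g hg x hx

end
end

section
/- Let n ≥ 2, ω ∈ S^{n−1}, 0 < r < 1/2, and let x = (1−r/2)ω, so that x lies on the radial segment joining the origin with ω and |x−ω| = r/2. Then there exist constants c₂ ≥ c₁ > 0 depending only on n such that for all y ∈ B ∩ B(ω, r): (1) c₁ r^{−n} ≤ |det DT_x(y)| ≤ c₂ r^{−n}, where det DT_x(y) is the Jacobian determinant of T_x at y; and (2) c₁/r ≤ (1−|T_x(y)|)/(1−|y|) ≤ c₂/r. -/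
open MeasureTheory Metric Set Filter
open scoped ENNReal NNReal Topology Classical

noncomputable section

open scoped RealInnerProductSpace

theorem denom_mobiusT_eq {n : ℕ} {x : Vec n} (hx : x ≠ 0) (y : Vec n) :
    ‖x‖ ^ 2 * ‖y - (‖x‖ ^ 2)⁻¹ • x‖ ^ 2 = 1 - 2 * ⟪x, y⟫ + ‖x‖ ^ 2 * ‖y‖ ^ 2 := by
  have hs : ‖x‖ ≠ 0 := norm_ne_zero_iff.2 hx
  rw [norm_sub_sq_real, norm_smul, inner_smul_right, real_inner_comm, mul_pow, Real.norm_eq_abs,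
    sq_abs]
  field_simp
  ring

/-- A point of the open ball is never the pole of `T_x`. -/
theorem denom_mobiusT_pos {n : ℕ} {x y : Vec n} (hx : x ≠ 0) (hx1 : ‖x‖ < 1) (hy : ‖y‖ < 1) :
    0 < ‖x‖ ^ 2 * ‖y - (‖x‖ ^ 2)⁻¹ • x‖ ^ 2 := by
  rw [denom_mobiusT_eq hx]
  have h1 := real_inner_le_norm x y
  have h2 : ‖x‖ * ‖y‖ < 1 := mul_lt_one_of_nonneg_of_lt_one_left (norm_nonneg x) hx1 hy.le
  nlinarith

/-- `T_x` is an inversion centred at `x / |x|²` followed by a Euclidean isometry. -/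
theorem mobiusT_eq_reflection_inversion {n : ℕ} {x y : Vec n} {R : ℝ} (hx : x ≠ 0)
    (hR : R ^ 2 = (1 - ‖x‖ ^ 2) / ‖x‖ ^ 2) (hy : y ≠ (‖x‖ ^ 2)⁻¹ • x) :
    mobiusT n x y =
      (ℝ ∙ x)ᗮ.reflection
        (EuclideanGeometry.inversion ((‖x‖ ^ 2)⁻¹ • x) R y - (‖x‖ ^ 2)⁻¹ • x) -
      (‖x‖ ^ 2)⁻¹ • x := by
  have hs : ‖x‖ ≠ 0 := norm_ne_zero_iff.2 hx
  obtain ⟨z, rfl⟩ : ∃ z, y = z + (‖x‖ ^ 2)⁻¹ • x := ⟨y - (‖x‖ ^ 2)⁻¹ • x, by simp⟩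
  have hz : ‖z‖ ≠ 0 := norm_ne_zero_iff.2 fun h => hy (by simp [h])
  have hzx : z + (‖x‖ ^ 2)⁻¹ • x - x = z + ((1 - ‖x‖ ^ 2) / ‖x‖ ^ 2) • x := by
    rw [sub_div, div_self (pow_ne_zero 2 hs), sub_smul, one_div, one_smul, add_sub_assoc]
  rw [mobiusT, if_neg hx, EuclideanGeometry.inversion, hzx]
  simp only [vsub_eq_sub, vadd_eq_add, add_sub_cancel_right, dist_eq_norm, map_smul,
    Submodule.reflection_orthogonal_apply, Submodule.reflection_singleton_apply, div_pow, hR]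
  rw [norm_add_sq_real, norm_smul, inner_smul_right, real_inner_comm, mul_pow, Real.norm_eq_abs,
    sq_abs]
  simp only [RCLike.ofReal_real_eq_id, id]
  match_scalars <;> field_simp
  ring

theorem abs_det_fderiv_mobiusT {n : ℕ} {x y : Vec n} (hx : x ≠ 0) (hx1 : ‖x‖ < 1)
    (hy : ‖y‖ < 1) :
    |(fderiv ℝ (mobiusT n x) y).det| =
      ((1 - ‖x‖ ^ 2) / (‖x‖ ^ 2 * ‖y - (‖x‖ ^ 2)⁻¹ • x‖ ^ 2)) ^ n := by
  have hs : 0 < ‖x‖ := norm_pos_iff.2 hx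
  have hs1 : 0 ≤ 1 - ‖x‖ ^ 2 := by nlinarith
  have hR := Real.sq_sqrt (div_nonneg hs1 (sq_nonneg ‖x‖))
  set R := √((1 - ‖x‖ ^ 2) / ‖x‖ ^ 2)
  have hyc : y ≠ (‖x‖ ^ 2)⁻¹ • x := by
    rintro rfl
    simpa using denom_mobiusT_pos hx hx1 hy
  have hinv := EuclideanGeometry.hasFDerivAt_inversion (R := R) hyc
  have hcomp := (((ℝ ∙ x)ᗮ.reflection : Vec n →L[ℝ] Vec n).hasFDerivAt.comp y
    (hinv.sub_const ((‖x‖ ^ 2)⁻¹ • x))).sub_const ((‖x‖ ^ 2)⁻¹ • x)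
  have hev : mobiusT n x =ᶠ[𝓝 y] _ :=
    (eventually_ne_nhds hyc).mono fun z hz => mobiusT_eq_reflection_inversion hx hR hz
  have hdet (v : Vec n) :
      |LinearMap.det ((((ℝ ∙ v)ᗮ.reflection : Vec n →L[ℝ] Vec n)) : Vec n →ₗ[ℝ] Vec n)| = 1 := by
    have h := (ℝ ∙ v)ᗮ.det_reflection
    change |LinearMap.det (ℝ ∙ v)ᗮ.reflection.toLinearMap| = 1
    rw [h, abs_pow, abs_neg, abs_one, one_pow]
  rw [(hcomp.congr_of_eventuallyEq hev).fderiv, ContinuousLinearMap.det,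
    ContinuousLinearMap.toLinearMap_comp, LinearMap.det_comp, ContinuousLinearMap.toLinearMap_smul,
    LinearMap.det_smul, abs_mul, abs_mul, hdet, hdet, finrank_euclideanSpace_fin, one_mul, mul_one,
    abs_of_nonneg (by positivity), div_pow, hR, dist_eq_norm, div_div]

theorem one_sub_norm_mobiusT_sq {n : ℕ} {x y : Vec n} (hx : x ≠ 0) (hx1 : ‖x‖ < 1)
    (hy : ‖y‖ < 1) :
    1 - ‖mobiusT n x y‖ ^ 2 =
      (1 - ‖x‖ ^ 2) / (‖x‖ ^ 2 * ‖y - (‖x‖ ^ 2)⁻¹ • x‖ ^ 2) * (1 - ‖y‖ ^ 2) := by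
  have hD := denom_mobiusT_pos hx hx1 hy
  rw [mobiusT, if_neg hx, norm_smul, mul_pow, Real.norm_eq_abs, sq_abs]
  rw [denom_mobiusT_eq hx] at hD ⊢
  rw [norm_sub_sq_real, norm_smul, norm_smul, inner_smul_left, inner_smul_right, inner_sub_left,
    real_inner_self_eq_norm_sq, mul_pow, mul_pow, Real.norm_eq_abs, Real.norm_eq_abs, sq_abs,
    sq_abs, norm_sub_sq_real]
  rw [real_inner_comm] at hD ⊢
  simp only [conj_trivial]
  field_simp
  ring

/-- The conformal factor of `T_x` for `x = (1 - r / 2) ω` is comparable to `1 / r` near `ω`. -/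
theorem conformal_factor_mobiusT_bounds {n : ℕ} {ω y : Vec n} {r : ℝ} (hω : ‖ω‖ = 1)
    (hr : 0 < r) (hr2 : r < 1 / 2) (hy : ‖y‖ < 1) (hyω : ‖y - ω‖ < r) {x : Vec n}
    (hx : x = (1 - r / 2) • ω) :
    1 / 3 / r ≤ (1 - ‖x‖ ^ 2) / (‖x‖ ^ 2 * ‖y - (‖x‖ ^ 2)⁻¹ • x‖ ^ 2) ∧
      (1 - ‖x‖ ^ 2) / (‖x‖ ^ 2 * ‖y - (‖x‖ ^ 2)⁻¹ • x‖ ^ 2) ≤ 4 / r := by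
  have ht : 0 < 1 - r / 2 := by linarith
  have hxn : ‖x‖ = 1 - r / 2 := by rw [hx, norm_smul, hω, mul_one, Real.norm_of_nonneg ht.le]
  have hx0 : x ≠ 0 := norm_pos_iff.1 (hxn ▸ ht)
  have hden : ‖x‖ ^ 2 * ‖y - (‖x‖ ^ 2)⁻¹ • x‖ ^ 2 = ‖ω - (1 - r / 2) • y‖ ^ 2 := by
    rw [denom_mobiusT_eq hx0, hxn, norm_sub_sq_real, hω, norm_smul, inner_smul_right, mul_pow,
      Real.norm_eq_abs, sq_abs, hx, inner_smul_left, conj_trivial]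
    ring
  have hty : ‖(1 - r / 2) • y‖ ≤ 1 - r / 2 := by
    rw [norm_smul, Real.norm_of_nonneg ht.le]
    exact mul_le_of_le_one_right ht.le hy.le
  have hlow : r / 2 ≤ ‖ω - (1 - r / 2) • y‖ := by
    linarith [norm_sub_norm_le ω ((1 - r / 2) • y)]
  have hup : ‖ω - (1 - r / 2) • y‖ ≤ 3 / 2 * r := by
    have hdecomp : ω - (1 - r / 2) • y = (r / 2) • y - (y - ω) := by module
    have hry : ‖(r / 2) • y‖ ≤ r / 2 := by
      rw [norm_smul, Real.norm_of_nonneg (by positivity)]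
      exact mul_le_of_le_one_right (by positivity) hy.le
    rw [hdecomp]
    linarith [norm_sub_le ((r / 2) • y) (y - ω)]
  rw [hden, hxn]
  set d := ‖ω - (1 - r / 2) • y‖
  have hd : 0 < d := by linarith
  rw [div_div, div_le_div_iff₀ (by positivity) (by positivity),
    div_le_div_iff₀ (by positivity) hr]
  have h1 : d ^ 2 ≤ (3 / 2 * r) ^ 2 := pow_le_pow_left₀ hd.le hup 2
  have h2 : (r / 2) ^ 2 ≤ d ^ 2 := pow_le_pow_left₀ (by positivity) hlow 2
  have h3 : 0 < r ^ 2 := by positivity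
  constructor <;> nlinarith

theorem mobius_jacobian_estimates (n : ℕ) (hn : 2 ≤ n) :
    ∃ c₁ c₂ : ℝ, 0 < c₁ ∧ c₁ ≤ c₂ ∧
      ∀ ω ∈ unitSphere n, ∀ r : ℝ, 0 < r → r < 1 / 2 →
        ∀ y ∈ unitBall n ∩ Metric.ball ω r,
          (c₁ / r ^ n ≤ |(fderiv ℝ (mobiusT n ((1 - r / 2) • ω)) y).det| ∧
            |(fderiv ℝ (mobiusT n ((1 - r / 2) • ω)) y).det| ≤ c₂ / r ^ n) ∧
          (c₁ / r ≤ (1 - ‖mobiusT n ((1 - r / 2) • ω) y‖) / (1 - ‖y‖) ∧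
            (1 - ‖mobiusT n ((1 - r / 2) • ω) y‖) / (1 - ‖y‖) ≤ c₂ / r) := by
  have hn0 : n ≠ 0 := by omega
  refine ⟨(1 / 6) ^ n, 8 ^ n, by positivity, pow_le_pow_left₀ (by norm_num) (by norm_num) n, ?_⟩
  rintro ω hω r hr hr2 y ⟨hy, hyω⟩
  replace hω : ‖ω‖ = 1 := mem_sphere_zero_iff_norm.1 hω
  replace hy : ‖y‖ < 1 := mem_ball_zero_iff.1 hy
  replace hyω : ‖y - ω‖ < r := mem_ball_iff_norm.1 hyω
  set x : Vec n := (1 - r / 2) • ω with hx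
  have hxn : ‖x‖ = 1 - r / 2 := by
    rw [hx, norm_smul, hω, mul_one, Real.norm_of_nonneg (by linarith)]
  have hx1 : ‖x‖ < 1 := by linarith
  have hx0 : x ≠ 0 := norm_pos_iff.1 (by linarith)
  obtain ⟨hlow, hup⟩ := conformal_factor_mobiusT_bounds hω hr hr2 hy hyω hx
  have hdet := abs_det_fderiv_mobiusT hx0 hx1 hy
  have hT := one_sub_norm_mobiusT_sq hx0 hx1 hy
  set q := (1 - ‖x‖ ^ 2) / (‖x‖ ^ 2 * ‖y - (‖x‖ ^ 2)⁻¹ • x‖ ^ 2)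
  have hq : 0 < q := lt_of_lt_of_le (by positivity) hlow
  set T := ‖mobiusT n x y‖
  have hT0 : 0 ≤ T := norm_nonneg _
  have hy0 : 0 ≤ ‖y‖ := norm_nonneg y
  have hT1 : T < 1 := by
    have : 0 < q * (1 - ‖y‖ ^ 2) := mul_pos hq (by nlinarith)
    nlinarith
  have hratio : (1 - T) / (1 - ‖y‖) = q * ((1 + ‖y‖) / (1 + T)) := by
    have h1 : 1 - ‖y‖ ≠ 0 := by linarith
    have h2 : 1 + T ≠ 0 := by linarith
    field_simp
    linear_combination hT
  have hf1 : 1 / 2 ≤ (1 + ‖y‖) / (1 + T) := by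
    rw [div_le_div_iff₀ (by norm_num) (by linarith)]; linarith
  have hf2 : (1 + ‖y‖) / (1 + T) ≤ 2 := by
    rw [div_le_iff₀ (by linarith)]; linarith
  refine ⟨?_, ?_⟩
  · rw [hdet, ← div_pow, ← div_pow]
    constructor
    · refine pow_le_pow_left₀ (by positivity) (le_trans ?_ hlow) n
      gcongr
      norm_num
    · refine pow_le_pow_left₀ hq.le (hup.trans ?_) n
      gcongr
      norm_num
  · rw [hratio]
    constructor
    · calc (1 / 6) ^ n / r ≤ 1 / 6 / r := by
            gcongr
            exact pow_le_of_le_one (by norm_num) (by norm_num) hn0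
        _ = 1 / 3 / r * (1 / 2) := by ring
        _ ≤ q * ((1 + ‖y‖) / (1 + T)) := mul_le_mul hlow hf1 (by norm_num) hq.le
    · calc q * ((1 + ‖y‖) / (1 + T)) ≤ 4 / r * 2 :=
            mul_le_mul hup hf2 (by positivity) (by positivity)
        _ = 8 / r := by ring
        _ ≤ 8 ^ n / r := by
            gcongr
            exact le_self_pow₀ (by norm_num) hn0

end
end
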